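/- arXiv:2603.29277 — 3 statements merged into one kernel-verified Lean document; each statement's English description precedes it below -/
import Mathlib

section
/- Let r = 3 and q = 8. For every ε > 0 there exist ζ > 0 and n₀ such that for all n ≥ n₀ with 3 | n: if G is an n-vertex graph with minimum degree δ(G) ≥ (11/16 + ε)·n and f : E(G) → {1,…,8} is any 8-edge-coloring of G, then there is a K_3-tiling T of G and a color c such that c appears on at least (e(T) + ζn)/8 of the edges of T. In other words, δ_{3,8} ≤ 11/16. -/
open Finset

variable {V : Type*}

/-- A `Kᵣ`-tiling of the vertex set `W`: a collection of pairwise-disjoint `r`-cliques of `G`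
whose union is `W`. -/
def IsKrTilingOn [DecidableEq V] (G : SimpleGraph V) (r : ℕ)
    (T : Finset (Finset V)) (W : Finset V) : Prop :=
  (∀ K ∈ T, G.IsNClique r K) ∧
  (∀ K ∈ T, ∀ K' ∈ T, K ≠ K' → Disjoint K K') ∧
  T.biUnion id = W

/-- A perfect `Kᵣ`-tiling of `G`. -/
def IsKrTiling [Fintype V] [DecidableEq V] (G : SimpleGraph V) (r : ℕ)
    (T : Finset (Finset V)) : Prop :=
  IsKrTilingOn G r T Finset.univ

/-- The number of edges of color `c` lying inside the cliques of `T`. -/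
def tilingColorCount [DecidableEq V] {q : ℕ} (f : Sym2 V → Fin q)
    (T : Finset (Finset V)) (c : Fin q) : ℕ :=
  ∑ K ∈ T, (K.sym2.filter fun e => ¬ e.IsDiag ∧ f e = c).card

/-- The total number of edges lying inside the cliques of `T`. -/
def tilingEdgeCount [DecidableEq V] (T : Finset (Finset V)) : ℕ :=
  ∑ K ∈ T, (K.sym2.filter fun e => ¬ e.IsDiag).card


/-- Partition of `W` into cliques of size at most three (empty pieces allowed). -/
def IsPart [DecidableEq V] (G : SimpleGraph V) (P : Finset (Finset V)) (W : Finset V) : Prop :=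
  (∀ K ∈ P, G.IsClique (K : Set V) ∧ K.card ≤ 3) ∧
  (∀ K ∈ P, ∀ K' ∈ P, K ≠ K' → Disjoint K K') ∧
  P.biUnion id = W

lemma IsPart.union [DecidableEq V] {G : SimpleGraph V} {P P' : Finset (Finset V)} {W W' : Finset V}
    (h : IsPart G P W) (h' : IsPart G P' W') (hd : Disjoint W W') :
    IsPart G (P ∪ P') (W ∪ W') := by
  obtain ⟨h1, h2, h3⟩ := h
  obtain ⟨h1', h2', h3'⟩ := h'
  have sub : ∀ K ∈ P, K ⊆ W := fun K hK => by
    rw [← h3]; exact Finset.subset_biUnion_of_mem id hK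
  have sub' : ∀ K ∈ P', K ⊆ W' := fun K hK => by
    rw [← h3']; exact Finset.subset_biUnion_of_mem id hK
  refine ⟨?_, ?_, ?_⟩
  · intro K hK
    rcases Finset.mem_union.1 hK with hK | hK
    · exact h1 K hK
    · exact h1' K hK
  · intro K hK K' hK' hne
    rcases Finset.mem_union.1 hK with hK | hK <;> rcases Finset.mem_union.1 hK' with hK' | hK'
    · exact h2 K hK K' hK' hne
    · exact hd.mono (sub K hK) (sub' K' hK')
    · exact (hd.mono (sub K' hK') (sub' K hK)).symm
    · exact h2' K hK K' hK' hne
  · rw [Finset.union_biUnion, h3, h3']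

def pw (P : Finset (Finset V)) : ℕ := ∑ K ∈ P, K.card ^ 2

lemma pw_union [DecidableEq V] {P P' : Finset (Finset V)}
    (hd : ∀ K ∈ P, K ∈ P' → K = ∅) : pw (P ∪ P') = pw P + pw P' := by
  unfold pw
  rw [← Finset.sum_union_inter]
  have : ∑ K ∈ P ∩ P', K.card ^ 2 = 0 := by
    apply Finset.sum_eq_zero
    intro K hK
    rw [Finset.mem_inter] at hK
    rw [hd K hK.1 hK.2]; simp
  omega

lemma pw_three [DecidableEq V] {A B C : Finset V} (h1 : Disjoint A B) (h2 : Disjoint A C)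
    (h3 : Disjoint B C) : pw {A, B, C} = A.card ^ 2 + B.card ^ 2 + C.card ^ 2 := by
  have e : ({A, B, C} : Finset (Finset V)) = {A} ∪ ({B} ∪ {C}) := by ext; simp; tauto
  rw [e, pw_union, pw_union]
  · simp [pw]; ring
  · intro K hK hK'
    simp only [Finset.mem_singleton] at hK hK'
    subst hK; subst hK'; simpa using h3
  · intro K hK hK'
    simp only [Finset.mem_singleton, Finset.mem_union] at hK hK'
    subst hK
    rcases hK' with rfl | rfl
    · simpa using h1
    · simpa using h2

def IsMaxPart [DecidableEq V] (G : SimpleGraph V) (P : Finset (Finset V)) (W : Finset V) : Prop :=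
  IsPart G P W ∧ ∀ P', IsPart G P' W → pw P' ≤ pw P

lemma exists_maxPart [Fintype V] [DecidableEq V] (G : SimpleGraph V) (W : Finset V) :
    ∃ P, IsMaxPart G P W := by
  classical
  have hne : (Finset.univ.filter fun P => IsPart G P W).Nonempty := by
    refine ⟨W.image (fun x => {x}), ?_⟩
    simp only [Finset.mem_filter, Finset.mem_univ, true_and]
    refine ⟨?_, ?_, ?_⟩
    · intro K hK
      obtain ⟨x, _, rfl⟩ := Finset.mem_image.1 hK
      simp
    · intro K hK K' hK' hne
      obtain ⟨x, _, rfl⟩ := Finset.mem_image.1 hK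
      obtain ⟨y, _, rfl⟩ := Finset.mem_image.1 hK'
      simpa using fun h => hne (by rw [h])
    · ext x; simp
  obtain ⟨P, hP, hmax⟩ := Finset.exists_max_image _ pw hne
  refine ⟨P, (Finset.mem_filter.1 hP).2, fun P' h' => hmax P' (by simp [h'])⟩

lemma IsMaxPart.exch [DecidableEq V] {G : SimpleGraph V} {P S : Finset (Finset V)} {W : Finset V}
    (h : IsMaxPart G P W) (hS : S ⊆ P) {A B C : Finset V}
    (hA : G.IsClique (A : Set V)) (hB : G.IsClique (B : Set V)) (hC : G.IsClique (C : Set V))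
    (hA3 : A.card ≤ 3) (hB3 : B.card ≤ 3) (hC3 : C.card ≤ 3)
    (h1 : Disjoint A B) (h2 : Disjoint A C) (h3 : Disjoint B C)
    (hU : A ∪ (B ∪ C) = S.biUnion id) :
    A.card ^ 2 + B.card ^ 2 + C.card ^ 2 ≤ pw S := by
  obtain ⟨⟨p1, p2, p3⟩, hmax⟩ := h
  have hd : Disjoint ((P \ S).biUnion id) (S.biUnion id) := by
    rw [Finset.disjoint_biUnion_left]
    intro K hK
    rw [Finset.disjoint_biUnion_right]
    intro K' hK'
    rw [Finset.mem_sdiff] at hK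
    exact p2 K hK.1 K' (hS hK') (fun e => hK.2 (e ▸ hK'))
  have q1 : IsPart G (P \ S) ((P \ S).biUnion id) :=
    ⟨fun K hK => p1 K (Finset.sdiff_subset hK),
      fun K hK K' hK' => p2 K (Finset.sdiff_subset hK) K' (Finset.sdiff_subset hK'), rfl⟩
  have q2 : IsPart G {A, B, C} (S.biUnion id) := by
    refine ⟨?_, ?_, ?_⟩
    · intro K hK
      simp only [Finset.mem_insert, Finset.mem_singleton] at hK
      rcases hK with rfl | rfl | rfl <;> exact ⟨by assumption, by assumption⟩
    · intro K hK K' hK' hne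
      simp only [Finset.mem_insert, Finset.mem_singleton] at hK hK'
      rcases hK with rfl | rfl | rfl <;> rcases hK' with rfl | rfl | rfl <;>
        first
        | exact absurd rfl hne
        | assumption
        | (apply Disjoint.symm; assumption)
    · rw [← hU]; ext x; simp
  have q3 := q1.union q2 hd
  have q4 : (P \ S).biUnion id ∪ S.biUnion id = W := by
    rw [← Finset.union_biUnion, Finset.sdiff_union_of_subset hS, p3]
  rw [q4] at q3
  have q5 := hmax _ q3
  rw [pw_union, pw_three h1 h2 h3] at q5
  · have q6 : pw P = pw (P \ S) + pw S := by
      unfold pw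
      rw [Finset.sum_sdiff hS]
    omega
  · intro K hK hK'
    have a1 : K ⊆ (P \ S).biUnion id := Finset.subset_biUnion_of_mem id hK
    have a2 : K ⊆ S.biUnion id := by
      rw [← q2.2.2]; exact Finset.subset_biUnion_of_mem id hK'
    simpa using hd.mono a1 a2


lemma pw_insert_le [DecidableEq V] (A : Finset V) (S : Finset (Finset V)) :
    pw (insert A S) ≤ A.card ^ 2 + pw S := by
  unfold pw
  by_cases h : A ∈ S
  · rw [Finset.insert_eq_of_mem h]; omega
  · rw [Finset.sum_insert h]

lemma pw_singleton (A : Finset V) : pw {A} = A.card ^ 2 := by simp [pw]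

/-- A vertex together with a set it is fully joined to forms a clique. -/
lemma isClique_insert' [DecidableEq V] {G : SimpleGraph V} {K : Finset V} {s : V}
    (hK : G.IsClique (K : Set V)) (h : ∀ y ∈ K, G.Adj s y) :
    G.IsClique ((insert s K : Finset V) : Set V) := by
  rw [Finset.coe_insert, SimpleGraph.isClique_insert]
  exact ⟨hK, fun b hb _ => h b hb⟩

section moves
variable [DecidableEq V] {G : SimpleGraph V} {P : Finset (Finset V)} {W : Finset V}

lemma IsMaxPart.mv1 (h : IsMaxPart G P W) {s s' : V} (hs : {s} ∈ P) (hs' : {s'} ∈ P)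
    (hne : s ≠ s') : ¬ G.Adj s s' := by
  intro hadj
  have := h.exch (S := {{s}, {s'}}) (A := {s, s'}) (B := ∅) (C := ∅)
    (by intro K hK; simp only [mem_insert, mem_singleton] at hK; rcases hK with rfl | rfl <;> assumption)
    (by
      have := isClique_insert' (G := G) (K := {s'}) (s := s) (by simp) (by simpa using hadj)
      exact this) (by simp) (by simp)
    (Finset.card_le_two.trans (by norm_num)) (by simp) (by simp) (by simp) (by simp) (by simp)
    (by ext; simp)
  have h2 := pw_insert_le {s} {({s'} : Finset V)}
  rw [pw_singleton] at h2
  rw [Finset.card_pair hne] at this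
  simp at h2 this
  omega

lemma IsMaxPart.mv5 (h : IsMaxPart G P W) {u v : V} {K : Finset V} (he : {u, v} ∈ P) (hK : K ∈ P)
    (hne : K ≠ {u, v}) (huv : G.Adj u v) (hc : K.card ≤ 2) {x : V} (hx : x ∈ K) :
    ¬ (G.Adj u x ∧ G.Adj v x) := by
  rintro ⟨h1, h2⟩
  have hd : Disjoint K {u, v} := h.1.2.1 K hK _ he hne
  have hKc := (h.1.1 K hK).1
  have hu : u ∉ K := fun hu => (Finset.disjoint_left.1 hd hu) (by simp)
  have hv : v ∉ K := fun hu => (Finset.disjoint_left.1 hd hu) (by simp)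
  have := h.exch (S := {{u, v}, K}) (A := {u, v, x}) (B := K.erase x) (C := ∅)
    (by intro K hK; simp only [mem_insert, mem_singleton] at hK; rcases hK with rfl | rfl <;> assumption)
    (SimpleGraph.is3Clique_triple_iff.2 ⟨huv, h1, h2⟩).1
    (hKc.subset (by simp)) (by simp) Finset.card_le_three
    ((Finset.card_le_card (Finset.erase_subset _ _)).trans (hc.trans (by norm_num))) (by simp)
    (by
      rw [Finset.disjoint_left]; intro a ha
      simp only [mem_insert, mem_singleton] at ha
      rcases ha with rfl | rfl | rfl <;> simp [hu, hv])
    (by simp) (by simp)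
    (by
      ext a; simp only [mem_union, mem_insert, mem_singleton, mem_erase, mem_biUnion, id, notMem_empty]
      constructor
      · rintro ((rfl | rfl | rfl) | ⟨_, ha⟩ | ha)
        · exact ⟨_, Or.inl rfl, by simp⟩
        · exact ⟨_, Or.inl rfl, by simp⟩
        · exact ⟨_, Or.inr rfl, hx⟩
        · exact ⟨_, Or.inr rfl, ha⟩
        · exact ha.elim
      · rintro ⟨_, rfl | rfl, ha⟩
        · simp only [mem_insert, mem_singleton] at ha; tauto
        · tauto)
  have e1 := (SimpleGraph.is3Clique_triple_iff.2 ⟨huv, h1, h2⟩).2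
  have e2 := Finset.card_erase_of_mem hx
  have e3 := Finset.card_pos.2 ⟨x, hx⟩
  have h3 := pw_insert_le {u, v} {K}
  rw [pw_singleton, Finset.card_pair huv.ne] at h3
  rw [e1, e2] at this
  rw [Finset.card_empty] at this
  have hcc : K.card = 1 ∨ K.card = 2 := by omega
  rcases hcc with e | e <;> rw [e] at this h3 <;> norm_num at this h3 <;> omega

lemma IsMaxPart.mv4 (h : IsMaxPart G P W) {s s' : V} {K : Finset V} (hs : {s} ∈ P) (hs' : {s'} ∈ P)
    (hK : K ∈ P) (hne : s ≠ s') (hn : K ≠ {s}) (hn' : K ≠ {s'}) {z : V} (hz : z ∈ K)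
    (h1 : G.Adj s z) : ¬ (∀ y ∈ K.erase z, G.Adj s' y) := by
  intro h2
  have hsK : s ∉ K := by simpa using h.1.2.1 K hK _ hs hn
  have hsK' : s' ∉ K := by simpa using h.1.2.1 K hK _ hs' hn'
  have hKc := h.1.1 K hK
  have e2 := Finset.card_erase_of_mem hz
  have e3 := Finset.card_pos.2 ⟨z, hz⟩
  have e4 : (insert s' (K.erase z)).card = K.card := by
    rw [Finset.card_insert_of_notMem (by simp [hsK'])]; omega
  have := h.exch (S := {{s}, {s'}, K}) (A := {s, z}) (B := insert s' (K.erase z)) (C := ∅)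
    (by intro K hK; simp only [mem_insert, mem_singleton] at hK; rcases hK with rfl | rfl | rfl <;> assumption)
    (isClique_insert' (K := {z}) (by simp) (by simpa using h1))
    (isClique_insert' (hKc.1.subset (by simp)) h2) (by simp)
    (Finset.card_le_two.trans (by norm_num)) (by rw [e4]; exact hKc.2) (by simp)
    (by
      rw [Finset.disjoint_left]; intro a ha
      simp only [mem_insert, mem_singleton] at ha
      rcases ha with rfl | rfl
      · simp [hsK, hne]
      · simp only [mem_insert, mem_erase]
        rintro (rfl | h)
        · exact hsK' hz
        · exact h.1 rfl)
    (by simp) (by simp)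
    (by
      ext a; simp only [mem_union, mem_insert, mem_singleton, mem_erase, mem_biUnion, id, notMem_empty]
      constructor
      · rintro ((rfl | rfl) | (rfl | ⟨_, ha⟩) | ha)
        · exact ⟨_, Or.inl rfl, by simp⟩
        · exact ⟨_, Or.inr (Or.inr rfl), hz⟩
        · exact ⟨_, Or.inr (Or.inl rfl), by simp⟩
        · exact ⟨_, Or.inr (Or.inr rfl), ha⟩
        · exact ha.elim
      · rintro ⟨_, rfl | rfl | rfl, ha⟩
        · simp only [mem_singleton] at ha; tauto
        · simp only [mem_singleton] at ha; tauto
        · tauto)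
  have h3 := pw_insert_le {s} {{s'}, K}
  have h4 := pw_insert_le {s'} {K}
  rw [pw_singleton] at h4
  rw [e4, Finset.card_pair h1.ne, Finset.card_empty] at this
  rw [Finset.card_singleton] at h3 h4
  omega

lemma IsMaxPart.mv6 (h : IsMaxPart G P W) {u v u' v' : V} {K : Finset V} (he : {u, v} ∈ P)
    (he' : {u', v'} ∈ P) (hK : K ∈ P) (huv : G.Adj u v) (huv' : G.Adj u' v')
    (hne : ({u, v} : Finset V) ≠ {u', v'})
    (hc : K.card = 3) {x : V} (hx : x ∈ K)
    (h1 : G.Adj u x) (h2 : G.Adj v x) : ¬ (∀ y ∈ K.erase x, G.Adj u' y) := by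
  intro h3
  have hn : K ≠ {u, v} := by
    rintro rfl; rw [Finset.card_pair huv.ne] at hc; omega
  have hn' : K ≠ {u', v'} := by
    rintro rfl; rw [Finset.card_pair huv'.ne] at hc; omega
  have hd : Disjoint K {u, v} := h.1.2.1 K hK _ he hn
  have hd' : Disjoint K {u', v'} := h.1.2.1 K hK _ he' hn'
  have hdd : Disjoint {u, v} {u', v'} := h.1.2.1 _ he _ he' hne
  simp only [disjoint_insert_right, disjoint_singleton_right] at hd hd' 
  simp only [disjoint_insert_right, disjoint_singleton_right, mem_insert, mem_singleton, not_or] at hdd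
  have hKc := h.1.1 K hK
  have e2 := Finset.card_erase_of_mem hx
  have e4 : (insert u' (K.erase x)).card = 3 := by
    rw [Finset.card_insert_of_notMem (by simp [hd'.1])]; omega
  have q1 : ∀ a ∈ K, a ≠ u ∧ a ≠ v ∧ a ≠ u' ∧ a ≠ v' := by
    intro a ha
    refine ⟨?_, ?_, ?_, ?_⟩ <;> rintro rfl <;> tauto
  have := h.exch (S := {{u, v}, {u', v'}, K}) (A := {u, v, x}) (B := insert u' (K.erase x)) (C := {v'})
    (by intro K hK; simp only [mem_insert, mem_singleton] at hK; rcases hK with rfl | rfl | rfl <;> assumption)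
    (SimpleGraph.is3Clique_triple_iff.2 ⟨huv, h1, h2⟩).1
    (isClique_insert' (hKc.1.subset (by simp)) h3) (by simp)
    Finset.card_le_three e4.le (by simp)
    (by
      rw [Finset.disjoint_left]; intro a ha
      simp only [mem_insert, mem_singleton] at ha
      simp only [mem_insert, mem_erase]
      have := q1 x hx
      rcases ha with rfl | rfl | rfl <;> tauto)
    (by
      have := q1 x hx
      simp only [disjoint_singleton_right, mem_insert, mem_singleton]
      tauto)
    (by
      simp only [disjoint_singleton_right, mem_insert, mem_erase]
      have := huv'.ne
      rintro (h | h)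
      · exact this h.symm
      · exact hd'.2 h.2)
    (by
      ext a; simp only [mem_union, mem_insert, mem_singleton, mem_erase, mem_biUnion, id]
      constructor
      · rintro ((rfl | rfl | rfl) | (rfl | ⟨_, ha⟩) | rfl)
        · exact ⟨_, Or.inl rfl, by simp⟩
        · exact ⟨_, Or.inl rfl, by simp⟩
        · exact ⟨_, Or.inr (Or.inr rfl), hx⟩
        · exact ⟨_, Or.inr (Or.inl rfl), by simp⟩
        · exact ⟨_, Or.inr (Or.inr rfl), ha⟩
        · exact ⟨_, Or.inr (Or.inl rfl), by simp⟩
      · rintro ⟨_, rfl | rfl | rfl, ha⟩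
        · simp only [mem_insert, mem_singleton] at ha; tauto
        · simp only [mem_insert, mem_singleton] at ha; tauto
        · tauto)
  have h5 := pw_insert_le {u, v} {{u', v'}, K}
  have h4 := pw_insert_le {u', v'} {K}
  rw [pw_singleton] at h4
  have e1 := (SimpleGraph.is3Clique_triple_iff.2 ⟨huv, h1, h2⟩).2
  rw [e1, e4, Finset.card_singleton] at this
  rw [Finset.card_pair huv.ne] at h5
  rw [Finset.card_pair huv'.ne, hc] at h4
  omega
end moves

set_option linter.unusedSectionVars false
set_option linter.unusedVariables false

/-- Degree of `v` into the set `W`. -/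
def dg (G : SimpleGraph V) [DecidableRel G.Adj] (W : Finset V) (v : V) : ℕ :=
  (W.filter (G.Adj v)).card

section near
variable [DecidableEq V] {G : SimpleGraph V} [DecidableRel G.Adj]
  {P : Finset (Finset V)} {W : Finset V}

lemma IsPart.sum_dg (h : IsPart G P W) (v : V) : dg G W v = ∑ K ∈ P, dg G K v := by
  unfold dg
  rw [← h.2.2, Finset.filter_biUnion, Finset.card_biUnion]
  · rfl
  · intro K hK K' hK' hne
    exact (h.2.1 K hK K' hK' hne).mono (Finset.filter_subset _ _) (Finset.filter_subset _ _)

lemma IsPart.sum_card (h : IsPart G P W) : W.card = ∑ K ∈ P, K.card := by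
  rw [← h.2.2, Finset.card_biUnion]
  · rfl
  · intro K hK K' hK' hne
    exact h.2.1 K hK K' hK' hne

lemma dg_one (x v : V) : dg G {x} v = if G.Adj v x then 1 else 0 := by
  unfold dg
  rw [Finset.filter_singleton]; split_ifs <;> simp

lemma dg_insert {x : V} {K : Finset V} (hx : x ∉ K) (v : V) :
    dg G (insert x K) v = (if G.Adj v x then 1 else 0) + dg G K v := by
  unfold dg
  rw [Finset.filter_insert]
  split_ifs with h
  · rw [Finset.card_insert_of_notMem (by simp [hx])]; ring
  · simp

lemma dg_two {x y : V} (hxy : x ≠ y) (v : V) : dg G {x, y} v =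
    (if G.Adj v x then 1 else 0) + (if G.Adj v y then 1 else 0) := by
  rw [dg_insert (by simpa using hxy), dg_one]

lemma dg_three {x y z : V} (hxy : x ≠ y) (hxz : x ≠ z) (hyz : y ≠ z) (v : V) :
    dg G {x, y, z} v =
    (if G.Adj v x then 1 else 0) + (if G.Adj v y then 1 else 0) + (if G.Adj v z then 1 else 0) := by
  rw [dg_insert (by simp [hxy, hxz]), dg_two hyz]; ring

lemma ite_aux {p q r : Prop} [Decidable p] [Decidable q] [Decidable r] (h : p → q → r → False) :
    (if p then 1 else 0) + (if q then 1 else 0) + (if r then 1 else 0) ≤ 2 := by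
  split_ifs <;> first | omega | exact (h (by assumption) (by assumption) (by assumption)).elim

lemma IsMaxPart.single_le (h : IsMaxPart G P W) {s s' : V} (hs : {s} ∈ P) (hs' : {s'} ∈ P)
    (hne : s ≠ s') {K : Finset V} (hK : K ∈ P) :
    3 * (dg G K s + dg G K s') ≤ 4 * K.card := by
  by_cases hn : K = {s}
  · subst hn
    rw [dg_one, dg_one, if_neg (G.irrefl), if_neg (fun e => h.mv1 hs hs' hne e.symm)]; simp
  by_cases hn' : K = {s'}
  · subst hn'
    rw [dg_one, dg_one, if_neg (G.irrefl), if_neg (h.mv1 hs hs' hne)]; simp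
  have hc := (h.1.1 K hK).2
  have m1 : ∀ z ∈ K, G.Adj s z → ¬ (∀ y ∈ K.erase z, G.Adj s' y) := fun z hz =>
    h.mv4 hs hs' hK hne hn hn' hz
  have m2 : ∀ z ∈ K, G.Adj s' z → ¬ (∀ y ∈ K.erase z, G.Adj s y) := fun z hz =>
    h.mv4 hs' hs hK hne.symm hn' hn hz
  interval_cases hcc : K.card
  · rw [Finset.card_eq_zero] at hcc; subst hcc; simp [dg]
  · obtain ⟨x, rfl⟩ := Finset.card_eq_one.1 hcc
    simp at m1 m2
    rw [dg_one, dg_one, if_neg m1, if_neg m2]; simp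
  · obtain ⟨x, y, hxy, rfl⟩ := Finset.card_eq_two.1 hcc
    rw [dg_two hxy, dg_two hxy]
    have a1 := m1 x (by simp)
    have a2 := m1 y (by simp)
    simp only [mem_erase, mem_insert, mem_singleton] at a1 a2
    have c1 : G.Adj s x → G.Adj s' y → False := fun h1 h2 =>
      a1 h1 (by rintro w ⟨q, rfl | rfl⟩ <;> tauto)
    have c2 : G.Adj s y → G.Adj s' x → False := fun h1 h2 =>
      a2 h1 (by rintro w ⟨q, rfl | rfl⟩ <;> tauto)
    clear a1 a2 m1 m2
    split_ifs <;> first | omega | (exfalso; tauto)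
  · obtain ⟨x, y, z, hxy, hxz, hyz, rfl⟩ := Finset.card_eq_three.1 hcc
    rw [dg_three hxy hxz hyz, dg_three hxy hxz hyz]
    have a1 := m1 x (by simp)
    have a2 := m1 y (by simp)
    have a3 := m1 z (by simp)
    have b1 := m2 x (by simp)
    have b2 := m2 y (by simp)
    have b3 := m2 z (by simp)
    simp only [mem_erase, mem_insert, mem_singleton] at a1 a2 a3 b1 b2 b3
    have c1 : G.Adj s x → G.Adj s' y → G.Adj s' z → False := fun h1 h2 h3 =>
      a1 h1 (by rintro w ⟨q, rfl | rfl | rfl⟩ <;> tauto)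
    have c2 : G.Adj s y → G.Adj s' x → G.Adj s' z → False := fun h1 h2 h3 =>
      a2 h1 (by rintro w ⟨q, rfl | rfl | rfl⟩ <;> tauto)
    have c3 : G.Adj s z → G.Adj s' x → G.Adj s' y → False := fun h1 h2 h3 =>
      a3 h1 (by rintro w ⟨q, rfl | rfl | rfl⟩ <;> tauto)
    have d1 : G.Adj s' x → G.Adj s y → G.Adj s z → False := fun h1 h2 h3 =>
      b1 h1 (by rintro w ⟨q, rfl | rfl | rfl⟩ <;> tauto)
    have d2 : G.Adj s' y → G.Adj s x → G.Adj s z → False := fun h1 h2 h3 =>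
      b2 h1 (by rintro w ⟨q, rfl | rfl | rfl⟩ <;> tauto)
    have d3 : G.Adj s' z → G.Adj s x → G.Adj s y → False := fun h1 h2 h3 =>
      b3 h1 (by rintro w ⟨q, rfl | rfl | rfl⟩ <;> tauto)
    clear a1 a2 a3 b1 b2 b3 m1 m2
    have c1 := ite_aux c1
    have c2 := ite_aux c2
    have c3 := ite_aux c3
    have d1 := ite_aux d1
    have d2 := ite_aux d2
    have d3 := ite_aux d3
    omega

lemma bool_aux (u1 u2 u3 v1 v2 v3 p1 p2 p3 q1 q2 q3 : ℕ)
    (hu1 : u1 ≤ 1) (hu2 : u2 ≤ 1) (hu3 : u3 ≤ 1) (hv1 : v1 ≤ 1) (hv2 : v2 ≤ 1) (hv3 : v3 ≤ 1)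
    (hp1 : p1 ≤ 1) (hp2 : p2 ≤ 1) (hp3 : p3 ≤ 1) (hq1 : q1 ≤ 1) (hq2 : q2 ≤ 1) (hq3 : q3 ≤ 1)
    (a1 : u1 + v1 + p2 + p3 ≤ 3) (a2 : u2 + v2 + p1 + p3 ≤ 3) (a3 : u3 + v3 + p1 + p2 ≤ 3)
    (b1 : u1 + v1 + q2 + q3 ≤ 3) (b2 : u2 + v2 + q1 + q3 ≤ 3) (b3 : u3 + v3 + q1 + q2 ≤ 3)
    (c1 : p1 + q1 + u2 + u3 ≤ 3) (c2 : p2 + q2 + u1 + u3 ≤ 3) (c3 : p3 + q3 + u1 + u2 ≤ 3)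
    (d1 : p1 + q1 + v2 + v3 ≤ 3) (d2 : p2 + q2 + v1 + v3 ≤ 3) (d3 : p3 + q3 + v1 + v2 ≤ 3) :
    u1 + u2 + u3 + (v1 + v2 + v3) + (p1 + p2 + p3) + (q1 + q2 + q3) ≤ 8 := by
  by_contra hcon
  have e1 : u1 = 0 ∨ u1 = 1 := by omega
  have e2 : u2 = 0 ∨ u2 = 1 := by omega
  have e3 : u3 = 0 ∨ u3 = 1 := by omega
  have e4 : v1 = 0 ∨ v1 = 1 := by omega
  have e5 : v2 = 0 ∨ v2 = 1 := by omega
  have e6 : v3 = 0 ∨ v3 = 1 := by omega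
  rcases e1 with rfl | rfl <;> rcases e2 with rfl | rfl <;> rcases e3 with rfl | rfl <;>
  rcases e4 with rfl | rfl <;> rcases e5 with rfl | rfl <;> rcases e6 with rfl | rfl <;> omega

lemma IsMaxPart.mv6' (h : IsMaxPart G P W) {u v u' v' x y z : V} (he : {u, v} ∈ P)
    (he' : {u', v'} ∈ P) (hK : {x, y, z} ∈ P) (huv : G.Adj u v) (huv' : G.Adj u' v')
    (hne : ({u, v} : Finset V) ≠ {u', v'}) (hxy : x ≠ y) (hxz : x ≠ z) (hyz : y ≠ z) :
    (if G.Adj u x then 1 else 0) + (if G.Adj v x then 1 else 0) + (if G.Adj u' y then 1 else 0)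
      + (if G.Adj u' z then 1 else 0) ≤ 3 := by
  have := h.mv6 he he' hK huv huv' hne (Finset.card_eq_three.2 ⟨x, y, z, hxy, hxz, hyz, rfl⟩)
    (x := x) (by simp)
  have c : G.Adj u x → G.Adj v x → G.Adj u' y → G.Adj u' z → False := fun h1 h2 h3 h4 =>
    this h1 h2 (by
      intro w hw
      simp only [mem_erase, mem_insert, mem_singleton] at hw
      rcases hw with ⟨q, rfl | rfl | rfl⟩ <;> tauto)
  split_ifs <;> first | omega | (exfalso; tauto)

lemma IsMaxPart.edge_le (h : IsMaxPart G P W) {u v : V} (he : {u, v} ∈ P)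
    (huv : G.Adj u v) {K : Finset V} (hK : K ∈ P) (hc : K.card ≤ 2) :
    dg G K u + dg G K v ≤ K.card := by
  by_cases hn : K = {u, v}
  · subst hn
    rw [dg_two huv.ne, dg_two huv.ne, Finset.card_pair huv.ne]
    simp [huv, huv.symm]
  have m := fun x => h.mv5 he hK hn huv hc (x := x)
  interval_cases hcc : K.card
  · rw [Finset.card_eq_zero] at hcc; subst hcc; simp [dg]
  · obtain ⟨x, rfl⟩ := Finset.card_eq_one.1 hcc
    have := m x (by simp)
    rw [dg_one, dg_one]
    split_ifs <;> first | omega | (exfalso; tauto)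
  · obtain ⟨x, y, hxy, rfl⟩ := Finset.card_eq_two.1 hcc
    rw [dg_two hxy, dg_two hxy]
    have := m x (by simp)
    have := m y (by simp)
    split_ifs <;> first | omega | (exfalso; tauto)

lemma IsMaxPart.edges_le (h : IsMaxPart G P W) {u v u' v' : V} (he : {u, v} ∈ P)
    (he' : {u', v'} ∈ P) (huv : G.Adj u v) (huv' : G.Adj u' v')
    (hne : ({u, v} : Finset V) ≠ {u', v'}) {K : Finset V} (hK : K ∈ P) :
    3 * (dg G K u + dg G K v + dg G K u' + dg G K v') ≤ 8 * K.card := by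
  by_cases hc : K.card ≤ 2
  · have := h.edge_le he huv hK hc
    have := h.edge_le he' huv' hK hc
    omega
  have hc3 : K.card = 3 := by
    have := (h.1.1 K hK).2
    omega
  obtain ⟨x, y, z, hxy, hxz, hyz, rfl⟩ := Finset.card_eq_three.1 hc3
  have r1 : ({y, x, z} : Finset V) = {x, y, z} := by ext; simp; tauto
  have r2 : ({z, x, y} : Finset V) = {x, y, z} := by ext; simp; tauto
  have s1 : ({v, u} : Finset V) = {u, v} := Finset.pair_comm _ _
  have s2 : ({v', u'} : Finset V) = {u', v'} := Finset.pair_comm _ _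
  rw [hc3]
  simp only [dg_three hxy hxz hyz]
  have := bool_aux (if G.Adj u x then 1 else 0) (if G.Adj u y then 1 else 0) (if G.Adj u z then 1 else 0)
    (if G.Adj v x then 1 else 0) (if G.Adj v y then 1 else 0) (if G.Adj v z then 1 else 0)
    (if G.Adj u' x then 1 else 0) (if G.Adj u' y then 1 else 0) (if G.Adj u' z then 1 else 0)
    (if G.Adj v' x then 1 else 0) (if G.Adj v' y then 1 else 0) (if G.Adj v' z then 1 else 0)
    (by split_ifs <;> simp) (by split_ifs <;> simp) (by split_ifs <;> simp) (by split_ifs <;> simp)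
    (by split_ifs <;> simp) (by split_ifs <;> simp) (by split_ifs <;> simp) (by split_ifs <;> simp)
    (by split_ifs <;> simp) (by split_ifs <;> simp) (by split_ifs <;> simp) (by split_ifs <;> simp)
    (h.mv6' he he' hK huv huv' hne hxy hxz hyz)
    (h.mv6' he he' (r1 ▸ hK) huv huv' hne hxy.symm hyz hxz)
    (h.mv6' he he' (r2 ▸ hK) huv huv' hne hxz.symm hyz.symm hxy)
    (h.mv6' he (s2 ▸ he') hK huv huv'.symm (s2 ▸ hne) hxy hxz hyz)
    (h.mv6' he (s2 ▸ he') (r1 ▸ hK) huv huv'.symm (s2 ▸ hne) hxy.symm hyz hxz)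
    (h.mv6' he (s2 ▸ he') (r2 ▸ hK) huv huv'.symm (s2 ▸ hne) hxz.symm hyz.symm hxy)
    (h.mv6' he' he hK huv' huv hne.symm hxy hxz hyz)
    (h.mv6' he' he (r1 ▸ hK) huv' huv hne.symm hxy.symm hyz hxz)
    (h.mv6' he' he (r2 ▸ hK) huv' huv hne.symm hxz.symm hyz.symm hxy)
    (h.mv6' he' (s1 ▸ he) hK huv' huv.symm (s1 ▸ hne.symm) hxy hxz hyz)
    (h.mv6' he' (s1 ▸ he) (r1 ▸ hK) huv' huv.symm (s1 ▸ hne.symm) hxy.symm hyz hxz)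
    (h.mv6' he' (s1 ▸ he) (r2 ▸ hK) huv' huv.symm (s1 ▸ hne.symm) hxz.symm hyz.symm hxy)
  omega

/-- Almost perfect triangle tilings above minimum degree `2/3`. -/
lemma near_tiling [Fintype V] (hdeg : ∀ v ∈ W, 2 * W.card < 3 * dg G W v) (h3 : 3 ∣ W.card) :
    ∃ T, IsKrTilingOn G 3 T W ∨ ∃ u v s, u ∈ W ∧ v ∈ W ∧ s ∈ W ∧ G.Adj u v ∧ s ≠ u ∧ s ≠ v ∧
      IsKrTilingOn G 3 T (W \ {u, v, s}) := by
  obtain ⟨P, hP⟩ := exists_maxPart G W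
  have sub : ∀ K ∈ P, K ⊆ W := fun K hK => by
    rw [← hP.1.2.2]; exact Finset.subset_biUnion_of_mem id hK
  -- at most one singleton
  have c1 : (P.filter fun K => K.card = 1).card ≤ 1 := by
    rw [Finset.card_le_one]
    intro A hA B hB
    rw [Finset.mem_filter] at hA hB
    obtain ⟨s, rfl⟩ := Finset.card_eq_one.1 hA.2
    obtain ⟨s', rfl⟩ := Finset.card_eq_one.1 hB.2
    by_contra hne
    have hss : s ≠ s' := fun e => hne (by rw [e])
    have t1 := hdeg s (sub _ hA.1 (by simp))
    have t2 := hdeg s' (sub _ hB.1 (by simp))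
    have : ∑ K ∈ P, 3 * (dg G K s + dg G K s') ≤ ∑ K ∈ P, 4 * K.card :=
      Finset.sum_le_sum fun K hK => hP.single_le hA.1 hB.1 hss hK
    rw [← Finset.mul_sum, ← Finset.mul_sum, Finset.sum_add_distrib, ← hP.1.sum_dg, ← hP.1.sum_dg,
      ← hP.1.sum_card] at this
    omega
  have hadj : ∀ u v : V, u ≠ v → {u, v} ∈ P → G.Adj u v := fun u v huv h =>
    (hP.1.1 _ h).1 (by simp) (by simp) huv
  have c2 : (P.filter fun K => K.card = 2).card ≤ 1 := by
    rw [Finset.card_le_one]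
    intro A hA B hB
    rw [Finset.mem_filter] at hA hB
    obtain ⟨u, v, huv, rfl⟩ := Finset.card_eq_two.1 hA.2
    obtain ⟨u', v', huv', rfl⟩ := Finset.card_eq_two.1 hB.2
    by_contra hne
    have t1 := hdeg u (sub _ hA.1 (by simp))
    have t2 := hdeg v (sub _ hA.1 (by simp))
    have t3 := hdeg u' (sub _ hB.1 (by simp))
    have t4 := hdeg v' (sub _ hB.1 (by simp))
    have : ∑ K ∈ P, 3 * (dg G K u + dg G K v + dg G K u' + dg G K v') ≤ ∑ K ∈ P, 8 * K.card :=
      Finset.sum_le_sum fun K hK => hP.edges_le hA.1 hB.1 (hadj _ _ huv hA.1) (hadj _ _ huv' hB.1)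
        hne hK
    rw [← Finset.mul_sum, ← Finset.mul_sum, Finset.sum_add_distrib, Finset.sum_add_distrib,
      Finset.sum_add_distrib, ← hP.1.sum_dg, ← hP.1.sum_dg, ← hP.1.sum_dg, ← hP.1.sum_dg,
      ← hP.1.sum_card] at this
    omega
  have hsum : W.card = (P.filter fun K => K.card = 1).card + 2 * (P.filter fun K => K.card = 2).card
      + 3 * (P.filter fun K => K.card = 3).card := by
    rw [hP.1.sum_card, Finset.card_filter, Finset.card_filter, Finset.card_filter, Finset.mul_sum,
      Finset.mul_sum, ← Finset.sum_add_distrib, ← Finset.sum_add_distrib]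
    apply Finset.sum_congr rfl
    intro K hK
    have := (hP.1.1 K hK).2
    interval_cases K.card <;> simp
  set T := P.filter fun K => K.card = 3 with hT
  have hTt : IsKrTilingOn G 3 T (T.biUnion id) := by
    refine ⟨fun K hK => ?_, fun K hK K' hK' => ?_, rfl⟩
    · rw [hT, Finset.mem_filter] at hK
      exact ⟨(hP.1.1 K hK.1).1, hK.2⟩
    · exact hP.1.2.1 K (Finset.filter_subset _ _ hK) K' (Finset.filter_subset _ _ hK')
  have hcc : ((P.filter fun K => K.card = 1).card = 0 ∧ (P.filter fun K => K.card = 2).card = 0) ∨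
     ((P.filter fun K => K.card = 1).card = 1 ∧ (P.filter fun K => K.card = 2).card = 1) := by
    omega
  refine ⟨T, ?_⟩
  rcases hcc with ⟨e1, e2⟩ | ⟨e1, e2⟩
  · left
    convert hTt using 1
    rw [← hP.1.2.2]
    rw [Finset.card_eq_zero, Finset.filter_eq_empty_iff] at e1 e2
    ext a
    simp only [mem_biUnion, id, hT, mem_filter]
    constructor
    · rintro ⟨K, hK, ha⟩
      have := e1 hK
      have := e2 hK
      have := (hP.1.1 K hK).2
      have : K.card ≠ 0 := Finset.card_ne_zero_of_mem ha
      exact ⟨K, ⟨hK, by omega⟩, ha⟩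
    · rintro ⟨K, hK, ha⟩
      exact ⟨K, hK.1, ha⟩
  · right
    obtain ⟨A, hA⟩ := Finset.card_eq_one.1 e1
    obtain ⟨B, hB⟩ := Finset.card_eq_one.1 e2
    have hA' : A ∈ P ∧ A.card = 1 := by
      have : A ∈ (P.filter fun K => K.card = 1) := by rw [hA]; simp
      exact Finset.mem_filter.1 this
    have hB' : B ∈ P ∧ B.card = 2 := by
      have : B ∈ (P.filter fun K => K.card = 2) := by rw [hB]; simp
      exact Finset.mem_filter.1 this
    have hAB : A ≠ B := by rintro rfl; omega
    have hd := hP.1.2.1 A hA'.1 B hB'.1 hAB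
    obtain ⟨s, rfl⟩ := Finset.card_eq_one.1 hA'.2
    obtain ⟨u, v, huv, rfl⟩ := Finset.card_eq_two.1 hB'.2
    simp only [disjoint_singleton_left, mem_insert, mem_singleton, not_or] at hd
    refine ⟨u, v, s, sub _ hB'.1 (by simp), sub _ hB'.1 (by simp), sub _ hA'.1 (by simp),
      hadj _ _ huv hB'.1, hd.1, hd.2, ?_⟩
    convert hTt using 1
    rw [← hP.1.2.2]
    ext a
    simp only [mem_biUnion, id, hT, mem_filter, mem_sdiff, mem_insert, mem_singleton, not_or]
    constructor
    · rintro ⟨⟨K, hK, ha⟩, h1, h2, h4⟩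
      have k0 : K.card ≠ 0 := Finset.card_ne_zero_of_mem ha
      have k1 : K.card ≠ 1 := by
        intro k
        have : K ∈ (P.filter fun K => K.card = 1) := Finset.mem_filter.2 ⟨hK, k⟩
        rw [hA, Finset.mem_singleton] at this
        subst this
        simp at ha; tauto
      have k2 : K.card ≠ 2 := by
        intro k
        have : K ∈ (P.filter fun K => K.card = 2) := Finset.mem_filter.2 ⟨hK, k⟩
        rw [hB, Finset.mem_singleton] at this
        subst this
        simp at ha; tauto
      have := (hP.1.1 K hK).2
      exact ⟨K, ⟨hK, by omega⟩, ha⟩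
    · rintro ⟨K, ⟨hK, k3⟩, ha⟩
      have d1 := hP.1.2.1 K hK _ hA'.1 (by rintro rfl; omega)
      have d2 := hP.1.2.1 K hK _ hB'.1 (by rintro rfl; omega)
      rw [Finset.disjoint_left] at d1 d2
      have := d1 ha
      have := d2 ha
      simp only [mem_insert, mem_singleton, not_or] at *
      exact ⟨⟨K, hK, ha⟩, by tauto⟩
end near


section tiling
variable [DecidableEq V] {G : SimpleGraph V}

lemma IsKrTilingOn.sub {T : Finset (Finset V)} {W : Finset V} (h : IsKrTilingOn G 3 T W)
    {K : Finset V} (hK : K ∈ T) : K ⊆ W := by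
  rw [← h.2.2]; exact Finset.subset_biUnion_of_mem id hK

lemma IsKrTilingOn.union {T T' : Finset (Finset V)} {W W' : Finset V}
    (h : IsKrTilingOn G 3 T W) (h' : IsKrTilingOn G 3 T' W') (hd : Disjoint W W') :
    IsKrTilingOn G 3 (T ∪ T') (W ∪ W') := by
  refine ⟨?_, ?_, ?_⟩
  · intro K hK
    rcases Finset.mem_union.1 hK with hK | hK
    · exact h.1 K hK
    · exact h'.1 K hK
  · intro K hK K' hK' hne
    rcases Finset.mem_union.1 hK with hK | hK <;> rcases Finset.mem_union.1 hK' with hK' | hK'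
    · exact h.2.1 K hK K' hK' hne
    · exact hd.mono (h.sub hK) (h'.sub hK')
    · exact (hd.mono (h.sub hK') (h'.sub hK)).symm
    · exact h'.2.1 K hK K' hK' hne
  · rw [Finset.union_biUnion, h.2.2, h'.2.2]

lemma IsKrTilingOn.disj {T T' : Finset (Finset V)} {W W' : Finset V}
    (h : IsKrTilingOn G 3 T W) (h' : IsKrTilingOn G 3 T' W') (hd : Disjoint W W') :
    Disjoint T T' := by
  rw [Finset.disjoint_left]
  intro K hK hK'
  have := hd.mono (h.sub hK) (h'.sub hK')
  simp only [disjoint_self, bot_eq_empty] at this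
  have h3 := (h.1 K hK).2
  rw [this] at h3
  simp at h3

lemma IsKrTilingOn.card_eq {T : Finset (Finset V)} {W : Finset V}
    (h : IsKrTilingOn G 3 T W) : W.card = 3 * T.card := by
  rw [← h.2.2, Finset.card_biUnion]
  · rw [Finset.sum_const_nat (m := 3) (fun K hK => by exact (h.1 K hK).2)]; ring
  · intro K hK K' hK' hne
    exact h.2.1 K hK K' hK' hne

lemma IsKrTilingOn.single {x y z : V} (h1 : G.Adj x y) (h2 : G.Adj x z) (h3 : G.Adj y z) :
    IsKrTilingOn G 3 {{x, y, z}} {x, y, z} := by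
  refine ⟨?_, ?_, ?_⟩
  · simpa using SimpleGraph.is3Clique_triple_iff.2 ⟨h1, h2, h3⟩
  · intro K hK K' hK' hne
    simp only [mem_singleton] at hK hK'
    exact absurd (hK.trans hK'.symm) hne
  · simp

lemma IsKrTilingOn.empty : IsKrTilingOn G 3 ∅ ∅ := by
  refine ⟨by simp, by simp, by simp⟩

lemma IsKrTilingOn.erase {T : Finset (Finset V)} {W K : Finset V}
    (h : IsKrTilingOn G 3 T W) (hK : K ∈ T) : IsKrTilingOn G 3 (T.erase K) (W \ K) := by
  refine ⟨fun K' hK' => h.1 K' (Finset.mem_of_mem_erase hK'), fun A hA B hB =>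
    h.2.1 A (Finset.mem_of_mem_erase hA) B (Finset.mem_of_mem_erase hB), ?_⟩
  rw [← h.2.2]
  ext a
  simp only [mem_biUnion, id, mem_erase, mem_sdiff]
  constructor
  · rintro ⟨A, ⟨hne, hA⟩, ha⟩
    exact ⟨⟨A, hA, ha⟩, Finset.disjoint_left.1 (h.2.1 A hA K hK hne) ha⟩
  · rintro ⟨⟨A, hA, ha⟩, hn⟩
    exact ⟨A, ⟨fun e => hn (e ▸ ha), hA⟩, ha⟩
end tiling

section absorb
variable [DecidableEq V] {G : SimpleGraph V} [DecidableRel G.Adj] {W : Finset V}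

lemma nonnbr_card (W : Finset V) (v : V) :
    (W.filter fun x => ¬ G.Adj v x).card + dg G W v = W.card := by
  unfold dg
  rw [add_comm]; exact Finset.card_filter_add_card_filter_not _

lemma cn3 (hdeg : ∀ v ∈ W, 11 * W.card ≤ 16 * dg G W v) {A : Finset V} {j : ℕ}
    (hA : (W \ A).card ≤ 3 * j) {a b c : V} (ha : a ∈ W) (hb : b ∈ W) (hc : c ∈ W) :
    W.card ≤ 16 * (A.filter fun x => G.Adj a x ∧ G.Adj b x ∧ G.Adj c x).card + 48 * j := by
  have hsub : W ⊆ (A.filter fun x => G.Adj a x ∧ G.Adj b x ∧ G.Adj c x) ∪ ((W \ A) ∪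
      ((W.filter fun x => ¬ G.Adj a x) ∪ ((W.filter fun x => ¬ G.Adj b x) ∪
        (W.filter fun x => ¬ G.Adj c x)))) := by
    intro x hx
    simp only [mem_union, mem_filter, mem_sdiff]
    tauto
  have h1 := Finset.card_le_card hsub
  have h2 := Finset.card_union_le (A.filter fun x => G.Adj a x ∧ G.Adj b x ∧ G.Adj c x) ((W \ A) ∪
      ((W.filter fun x => ¬ G.Adj a x) ∪ ((W.filter fun x => ¬ G.Adj b x) ∪
        (W.filter fun x => ¬ G.Adj c x))))
  have h3 := Finset.card_union_le (W \ A) 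
      ((W.filter fun x => ¬ G.Adj a x) ∪ ((W.filter fun x => ¬ G.Adj b x) ∪
        (W.filter fun x => ¬ G.Adj c x)))
  have h4 := Finset.card_union_le (W.filter fun x => ¬ G.Adj a x)
     ((W.filter fun x => ¬ G.Adj b x) ∪ (W.filter fun x => ¬ G.Adj c x))
  have h5 := Finset.card_union_le (W.filter fun x => ¬ G.Adj b x) (W.filter fun x => ¬ G.Adj c x)
  have n1 := nonnbr_card (G := G) W a
  have n2 := nonnbr_card (G := G) W b
  have n3 := nonnbr_card (G := G) W c
  have := hdeg a ha
  have := hdeg b hb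
  have := hdeg c hc
  omega

lemma triple_count {A : Finset V} {R : V × V × V → Prop} [DecidablePred R] {t : ℝ} (ht : 0 ≤ t)
    (S : Finset V) (S1 : V → Finset V) (S2 : V → V → Finset V)
    (hS : S ⊆ A) (hS1 : ∀ x, S1 x ⊆ A) (hS2 : ∀ x y, S2 x y ⊆ A)
    (c0 : t ≤ S.card) (c1 : ∀ x ∈ S, t ≤ (S1 x).card)
    (c2 : ∀ x ∈ S, ∀ y ∈ S1 x, t ≤ (S2 x y).card)
    (hR : ∀ x ∈ S, ∀ y ∈ S1 x, ∀ z ∈ S2 x y, R (x, y, z)) :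
    t ^ 3 ≤ ((A ×ˢ A ×ˢ A).filter R).card := by
  have hcard : (S.sigma fun x => (S1 x).sigma fun y => S2 x y).card ≤
      ((A ×ˢ A ×ˢ A).filter R).card := by
    apply Finset.card_le_card_of_injOn (fun p => (p.1, p.2.1, p.2.2))
    · rintro ⟨x, y, z⟩ hp
      simp only [coe_sigma, Set.mem_sigma_iff, mem_coe, mem_sigma] at hp
      simp only [coe_filter, mem_product, Set.mem_setOf_eq]
      exact ⟨⟨hS hp.1, hS1 _ hp.2.1, hS2 _ _ hp.2.2⟩, hR _ hp.1 _ hp.2.1 _ hp.2.2⟩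
    · rintro ⟨x, y, z⟩ _ ⟨x', y', z'⟩ _ h
      simp only [Prod.mk.injEq] at h
      obtain ⟨rfl, rfl, rfl⟩ := h
      rfl
  refine le_trans ?_ (Nat.cast_le.2 hcard)
  rw [Finset.card_sigma]
  push_cast
  calc t ^ 3 = t * (t * t) := by ring
    _ ≤ S.card * (t * t) := by gcongr
    _ = ∑ x ∈ S, t * t := by simp
    _ ≤ ∑ x ∈ S, (((S1 x).sigma fun y => S2 x y).card : ℝ) := by
        apply Finset.sum_le_sum
        intro x hx
        rw [Finset.card_sigma]
        push_cast
        calc t * t ≤ (S1 x).card * t := by gcongr; exact c1 x hx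
          _ = ∑ y ∈ S1 x, t := by simp
          _ ≤ _ := Finset.sum_le_sum fun y hy => c2 x hx y hy

/-- The triple `p = (u,v,s)` is absorbed by the triangle `q = (x,y,z)`. -/
def good (G : SimpleGraph V) (p q : V × V × V) : Prop :=
  G.Adj p.1 q.1 ∧ G.Adj p.2.1 q.1 ∧ G.Adj p.2.2 q.2.1 ∧ G.Adj p.2.2 q.2.2 ∧
    G.Adj q.1 q.2.1 ∧ G.Adj q.1 q.2.2 ∧ G.Adj q.2.1 q.2.2

def covd (G : SimpleGraph V) (F : Finset (Finset V)) (p : V × V × V) : Prop :=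
  ∃ q, {q.1, q.2.1, q.2.2} ∈ F ∧ good G p q

open Classical in
lemma good_count (hdeg : ∀ v ∈ W, 11 * W.card ≤ 16 * dg G W v) {A : Finset V} {j : ℕ}
    (hAW : A ⊆ W) (hA : (W \ A).card ≤ 3 * j) (hj : 96 * j ≤ W.card) {p : V × V × V}
    (hp : p ∈ W ×ˢ W ×ˢ W) :
    ((W.card : ℝ) / 32) ^ 3 ≤ ((A ×ˢ A ×ˢ A).filter (good G p)).card := by
  obtain ⟨u, v, s⟩ := p
  simp only [mem_product] at hp
  have key : ∀ a ∈ W, ∀ b ∈ W, ∀ c ∈ W, (W.card : ℝ) / 32 ≤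
      (A.filter fun x => G.Adj a x ∧ G.Adj b x ∧ G.Adj c x).card := by
    intro a ha b hb c hc
    have := cn3 hdeg hA ha hb hc
    have h2 : W.card ≤ 32 * (A.filter fun x => G.Adj a x ∧ G.Adj b x ∧ G.Adj c x).card := by omega
    have h3 : (W.card : ℝ) ≤ 32 * (A.filter fun x => G.Adj a x ∧ G.Adj b x ∧ G.Adj c x).card := by
      exact_mod_cast h2
    linarith
  apply triple_count (by positivity) (A.filter fun x => G.Adj u x ∧ G.Adj v x ∧ G.Adj v x)
    (fun x => A.filter fun y => G.Adj x y ∧ G.Adj s y ∧ G.Adj s y)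
    (fun x y => A.filter fun z => G.Adj x z ∧ G.Adj s z ∧ G.Adj y z)
  · exact Finset.filter_subset _ _
  · intro _; exact Finset.filter_subset _ _
  · intro _ _; exact Finset.filter_subset _ _
  · exact key u hp.1 v hp.2.1 v hp.2.1
  · intro x hx
    exact key x (hAW (Finset.mem_filter.1 hx).1) s hp.2.2 s hp.2.2
  · intro x hx y hy
    exact key x (hAW (Finset.mem_filter.1 hx).1) s hp.2.2 y (hAW (Finset.mem_filter.1 hy).1)
  · intro x hx y hy z hz
    simp only [mem_filter] at hx hy hz
    unfold good
    simp only
    tauto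

open Classical in
lemma greedy (hdeg : ∀ v ∈ W, 11 * W.card ≤ 16 * dg G W v) (j : ℕ) (hj : 96 * j ≤ W.card) :
    ∃ F R, IsKrTilingOn G 3 F R ∧ R ⊆ W ∧ F.card ≤ j ∧
      (((W ×ˢ W ×ˢ W).filter fun p => ¬ covd G F p).card : ℝ) ≤
        (W.card : ℝ) ^ 3 * (1 - 1 / 32768) ^ j := by
  induction j with
  | zero =>
    refine ⟨∅, ∅, IsKrTilingOn.empty, by simp, by simp, ?_⟩
    have := Finset.card_filter_le (W ×ˢ W ×ˢ W) (fun p => ¬ covd G ∅ p)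
    rw [Finset.card_product, Finset.card_product] at this
    have : (((W ×ˢ W ×ˢ W).filter fun p => ¬ covd G ∅ p).card : ℝ) ≤
      (W.card * (W.card * W.card) : ℕ) := by exact_mod_cast this
    push_cast at this
    linarith
  | succ j ih =>
    obtain ⟨F, R, hF, hR, hc, hU⟩ := ih (by omega)
    set U := (W ×ˢ W ×ˢ W).filter fun p => ¬ covd G F p with hUdef
    by_cases hU0 : U.card = 0
    · refine ⟨F, R, hF, hR, by omega, ?_⟩
      rw [← hUdef, hU0]; simp; positivity
    set A := W \ R with hA
    have hAW : A ⊆ W := Finset.sdiff_subset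
    have hWA : (W \ A).card ≤ 3 * j := by
      rw [hA, Finset.sdiff_sdiff_eq_self hR, hF.card_eq]; omega
    have hWpos : 0 < W.card := by omega
    -- double counting
    have dc : ∑ q ∈ A ×ˢ A ×ˢ A, ((U.filter fun p => good G p q).card : ℝ) =
        ∑ p ∈ U, (((A ×ˢ A ×ˢ A).filter (good G p)).card : ℝ) := by
      have := Finset.sum_card_bipartiteAbove_eq_sum_card_bipartiteBelow (good G) (s := U)
        (t := A ×ˢ A ×ˢ A)
      unfold Finset.bipartiteAbove Finset.bipartiteBelow at this
      exact_mod_cast this.symm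
    have lb : (U.card : ℝ) * ((W.card : ℝ) / 32) ^ 3 ≤
        ∑ q ∈ A ×ˢ A ×ˢ A, ((U.filter fun p => good G p q).card : ℝ) := by
      rw [dc]
      calc (U.card : ℝ) * ((W.card : ℝ) / 32) ^ 3 = ∑ p ∈ U, ((W.card : ℝ) / 32) ^ 3 := by simp
        _ ≤ _ := Finset.sum_le_sum fun p hp =>
          good_count hdeg hAW hWA (by omega) (Finset.mem_filter.1 hp).1
    have ex : ∃ q ∈ A ×ˢ A ×ˢ A, (U.card : ℝ) / 32768 ≤ (U.filter fun p => good G p q).card := by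
      by_contra hcon
      push Not at hcon
      have hAc : ((A ×ˢ A ×ˢ A).card : ℝ) ≤ (W.card : ℝ) ^ 3 := by
        have h1 : (A.card : ℝ) ≤ W.card := by exact_mod_cast Finset.card_le_card hAW
        rw [Finset.card_product, Finset.card_product]
        push_cast
        calc (A.card : ℝ) * (A.card * A.card) = (A.card : ℝ) ^ 3 := by ring
          _ ≤ _ := by gcongr
      have hUpos : (0 : ℝ) < U.card := by exact_mod_cast Nat.pos_of_ne_zero hU0
      have hWr : (0 : ℝ) < W.card := by exact_mod_cast hWpos
      rcases Finset.eq_empty_or_nonempty (A ×ˢ A ×ˢ A) with he | hne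
      · rw [he, Finset.sum_empty] at lb
        have : (0 : ℝ) < (U.card : ℝ) * ((W.card : ℝ) / 32) ^ 3 := by positivity
        linarith
      · have := Finset.sum_lt_sum_of_nonempty hne hcon
        rw [Finset.sum_const, nsmul_eq_mul] at this
        have h2 : ((A ×ˢ A ×ˢ A).card : ℝ) * ((U.card : ℝ) / 32768) ≤
            (W.card : ℝ) ^ 3 * ((U.card : ℝ) / 32768) := by gcongr
        have h3 : (U.card : ℝ) * ((W.card : ℝ) / 32) ^ 3 =
            (W.card : ℝ) ^ 3 * ((U.card : ℝ) / 32768) := by ring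
        linarith
    obtain ⟨q, hq, hqc⟩ := ex
    have hqpos : (0 : ℝ) < (U.filter fun p => good G p q).card := by
      refine lt_of_lt_of_le ?_ hqc
      have hUpos : (0 : ℝ) < U.card := by exact_mod_cast Nat.pos_of_ne_zero hU0
      positivity
    obtain ⟨p0, hp0⟩ := Finset.card_pos.1 (by exact_mod_cast hqpos)
    have hg := (Finset.mem_filter.1 hp0).2
    obtain ⟨x, y, z⟩ := q
    simp only [mem_product] at hq
    have hK : IsKrTilingOn G 3 {{x, y, z}} {x, y, z} :=
      IsKrTilingOn.single hg.2.2.2.2.1 hg.2.2.2.2.2.1 hg.2.2.2.2.2.2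
    have hsubA : ({x, y, z} : Finset V) ⊆ A := by
      intro a ha
      simp only [mem_insert, mem_singleton] at ha
      rcases ha with rfl | rfl | rfl
      · exact hq.1
      · exact hq.2.1
      · exact hq.2.2
    have hd : Disjoint R {x, y, z} := (Finset.disjoint_sdiff).mono_right hsubA
    refine ⟨F ∪ {{x, y, z}}, R ∪ {x, y, z}, hF.union hK hd, Finset.union_subset hR (hsubA.trans hAW),
      (Finset.card_union_le _ _).trans (by simpa using hc), ?_⟩
    have hsub : ((W ×ˢ W ×ˢ W).filter fun p => ¬ covd G (F ∪ {{x, y, z}}) p) ⊆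
        U \ (U.filter fun p => good G p (x, y, z)) := by
      intro p hp
      simp only [mem_filter, mem_sdiff, hUdef, not_and] at hp ⊢
      refine ⟨⟨hp.1, fun ⟨q, hq, hq'⟩ => hp.2 ⟨q, Finset.mem_union_left _ hq, hq'⟩⟩, fun _ hg => ?_⟩
      exact hp.2 ⟨(x, y, z), Finset.mem_union_right _ (by simp), hg⟩
    have h1 := Finset.card_le_card hsub
    have h2 := Finset.card_sdiff_add_card_eq_card (Finset.filter_subset (fun p => good G p (x, y, z)) U)
    have h1' : (((W ×ˢ W ×ˢ W).filter fun p => ¬ covd G (F ∪ {{x, y, z}}) p).card : ℝ) ≤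
      (U \ (U.filter fun p => good G p (x, y, z))).card := by exact_mod_cast h1
    have h2' : ((U \ (U.filter fun p => good G p (x, y, z))).card : ℝ) +
      (U.filter fun p => good G p (x, y, z)).card = U.card := by exact_mod_cast h2
    rw [pow_succ (1 - 1 / 32768 : ℝ) j, ← mul_assoc]
    have : (U.card : ℝ) * (1 - 1 / 32768) ≤ (W.card : ℝ) ^ 3 * (1 - 1 / 32768) ^ j * (1 - 1/32768) := by
      apply mul_le_mul_of_nonneg_right hU; norm_num
    linarith
end absorb

section CH

lemma num_lim (N : ℕ) : ∃ k0 : ℕ, ∀ k, k0 ≤ k →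
    ((N * (k + 1) : ℕ) : ℝ) ^ 3 * (1 - 1 / 32768) ^ k < 1 := by
  have h := tendsto_pow_const_mul_const_pow_of_abs_lt_one 3 (r := (1 - 1 / 32768 : ℝ))
    (by rw [abs_of_nonneg] <;> norm_num)
  have h2 := (h.comp (Filter.tendsto_add_atTop_nat 1)).const_mul ((N : ℝ) ^ 3 * 2)
  rw [mul_zero] at h2
  have h3 := h2.eventually_lt_const (show (0 : ℝ) < 1 by norm_num)
  obtain ⟨k0, hk⟩ := Filter.eventually_atTop.1 h3
  refine ⟨k0, fun k hk' => ?_⟩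
  have h4 := hk k hk'
  simp only [Function.comp] at h4
  refine lt_of_le_of_lt ?_ h4
  push_cast
  rw [pow_succ (1 - 1 / 32768 : ℝ) k]
  have : (0 : ℝ) ≤ ((N : ℝ) * (k + 1)) ^ 3 * (1 - 1 / 32768) ^ k := by positivity
  nlinarith [this]

lemma dg_sdiff_le [DecidableEq V] {G : SimpleGraph V} [DecidableRel G.Adj] (W R : Finset V) (v : V) :
    dg G W v ≤ dg G (W \ R) v + R.card := by
  unfold dg
  have : W.filter (G.Adj v) ⊆ (W \ R).filter (G.Adj v) ∪ R := by
    intro x hx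
    simp only [mem_filter, mem_union, mem_sdiff] at hx ⊢
    tauto
  exact (Finset.card_le_card this).trans (Finset.card_union_le _ _)

/-- Triangle tilings exist with minimum degree at least `11/16`. -/
lemma tile_exists : ∃ n0 : ℕ, ∀ {V : Type} [Fintype V] [DecidableEq V] (G : SimpleGraph V)
    [DecidableRel G.Adj] (W : Finset V), n0 ≤ W.card → 3 ∣ W.card →
    (∀ v ∈ W, 11 * W.card ≤ 16 * dg G W v) → ∃ T, IsKrTilingOn G 3 T W := by
  obtain ⟨k0, hk0⟩ := num_lim 1000
  refine ⟨1000 * (k0 + 1), ?_⟩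
  intro V _ _ G _ W hn h3 hdeg
  classical
  set k := W.card / 1000 with hk
  obtain ⟨F, R, hF, hR, hc, hU⟩ := greedy hdeg k (by omega)
  have hk1 := hk0 k (by omega)
  have hU0 : (((W ×ˢ W ×ˢ W).filter fun p => ¬ covd G F p).card : ℝ) < 1 := by
    refine lt_of_le_of_lt hU (lt_of_le_of_lt ?_ hk1)
    gcongr
    omega
  have hU1 : ((W ×ˢ W ×ˢ W).filter fun p => ¬ covd G F p).card = 0 := by
    have : ((W ×ˢ W ×ˢ W).filter fun p => ¬ covd G F p).card < 1 := by exact_mod_cast hU0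
    omega
  have hcov : ∀ p ∈ W ×ˢ W ×ˢ W, covd G F p := by
    intro p hp
    by_contra hcon
    have : p ∈ ((W ×ˢ W ×ˢ W).filter fun p => ¬ covd G F p) := by
      rw [Finset.mem_filter]; exact ⟨hp, hcon⟩
    rw [Finset.card_eq_zero] at hU1
    rw [hU1] at this; simp at this
  have hRc := hF.card_eq
  have hWR := Finset.card_sdiff_add_card_eq_card hR
  have hnear := near_tiling (G := G) (W := W \ R) (by
    intro v hv
    have h1 := dg_sdiff_le (G := G) W R v
    have h2 := hdeg v (Finset.mem_sdiff.1 hv).1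
    omega) (by omega)
  obtain ⟨T, hT | ⟨u, v, s, hu, hv, hs, huv, hsu, hsv, hT⟩⟩ := hnear
  · refine ⟨T ∪ F, ?_⟩
    have := hT.union hF Finset.sdiff_disjoint
    rwa [Finset.sdiff_union_of_subset hR] at this
  · obtain ⟨⟨x, y, z⟩, hq, hg⟩ := hcov (u, v, s) (by
      simp only [mem_product]
      exact ⟨(mem_sdiff.1 hu).1, (mem_sdiff.1 hv).1, (mem_sdiff.1 hs).1⟩)
    obtain ⟨g1, g2, g3, g4, g5, g6, g7⟩ := hg
    simp only at hq g1 g2 g3 g4 g5 g6 g7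
    have hxR := hF.sub hq
    have hx : x ∈ R := hxR (by simp)
    have hy : y ∈ R := hxR (by simp)
    have hz : z ∈ R := hxR (by simp)
    have hE := hF.erase hq
    have t1 := IsKrTilingOn.single huv g1 g2
    have t2 := IsKrTilingOn.single g3 g4 g7
    rw [mem_sdiff] at hu hv hs
    have e1 := huv.ne
    have e5 := g5.ne
    have e6 := g6.ne
    have d12 : Disjoint ({u, v, x} : Finset V) {s, y, z} := by
      rw [Finset.disjoint_left]
      intro a ha hb
      simp only [mem_insert, mem_singleton] at ha hb
      rcases ha with rfl | rfl | rfl <;> rcases hb with rfl | rfl | rfl <;> tauto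
    have t12 := t1.union t2 d12
    have dTE : Disjoint ((W \ R) \ {u, v, s}) (R \ {x, y, z}) :=
      (Finset.sdiff_disjoint (s := R) (t := W)).mono Finset.sdiff_subset Finset.sdiff_subset
    have tTE := hT.union hE dTE
    have dd : Disjoint (((W \ R) \ {u, v, s}) ∪ (R \ {x, y, z})) ({u, v, x} ∪ {s, y, z}) := by
      rw [Finset.disjoint_left]
      intro a ha hb
      simp only [mem_insert, mem_singleton, mem_union, mem_sdiff] at ha hb
      rcases hb with (rfl | rfl | rfl) | (rfl | rfl | rfl) <;> tauto
    have fin := tTE.union t12 dd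
    refine ⟨(T ∪ F.erase {x, y, z}) ∪ ({{u, v, x}} ∪ {{s, y, z}}), ?_⟩
    have : ((W \ R) \ {u, v, s}) ∪ (R \ {x, y, z}) ∪ ({u, v, x} ∪ {s, y, z}) = W := by
      ext a
      have := @hR a
      simp only [mem_insert, mem_singleton, mem_union, mem_sdiff]
      constructor
      · rintro ((h | h) | ((rfl | rfl | rfl) | (rfl | rfl | rfl))) <;> tauto
      · intro h; tauto
    rwa [this] at fin
end CH

section colour
variable [DecidableEq V] {G : SimpleGraph V}

/-- Indicator that `xy` has colour `c`. -/
def hh (f : Sym2 V → Fin 8) (c : Fin 8) (x y : V) : ℤ := if f s(x, y) = c then 1 else 0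

lemma hh_cases (f : Sym2 V → Fin 8) (c : Fin 8) (x y : V) : hh f c x y = 0 ∨ hh f c x y = 1 := by
  unfold hh; split_ifs <;> simp

lemma hh_comm (f : Sym2 V → Fin 8) (c : Fin 8) (x y : V) : hh f c x y = hh f c y x := by
  unfold hh; rw [Sym2.eq_swap]

lemma tri_sym2 {x y z : V} (h1 : x ≠ y) (h2 : x ≠ z) (h3 : y ≠ z) :
    (({x, y, z} : Finset V).sym2.filter fun e => ¬ e.IsDiag) = {s(x, y), s(x, z), s(y, z)} := by
  ext e
  induction e using Sym2.ind with
  | _ a b =>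
    simp only [mem_filter, mk_mem_sym2_iff, mem_insert, mem_singleton, Sym2.mk_isDiag_iff,
      Sym2.eq_iff]
    constructor
    · rintro ⟨⟨rfl | rfl | rfl, rfl | rfl | rfl⟩, h⟩ <;> tauto
    · rintro ((⟨rfl, rfl⟩ | ⟨rfl, rfl⟩) | (⟨rfl, rfl⟩ | ⟨rfl, rfl⟩) | (⟨rfl, rfl⟩ | ⟨rfl, rfl⟩)) <;> tauto

lemma edge_ne {x y z : V} (h1 : x ≠ y) (h2 : x ≠ z) (h3 : y ≠ z) :
    s(x, y) ≠ s(x, z) ∧ s(x, y) ≠ s(y, z) ∧ s(x, z) ≠ s(y, z) := by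
  simp only [ne_eq, Sym2.eq_iff]
  refine ⟨?_, ?_, ?_⟩ <;> rintro (⟨h, h'⟩ | ⟨h, h'⟩) <;> tauto

lemma tri_wt (f : Sym2 V → Fin 8) (c : Fin 8) {x y z : V} (h1 : x ≠ y) (h2 : x ≠ z) (h3 : y ≠ z) :
    ((tilingColorCount f {{x, y, z}} c : ℕ) : ℤ) = hh f c x y + hh f c x z + hh f c y z := by
  unfold tilingColorCount
  rw [Finset.sum_singleton, ← Finset.filter_filter, tri_sym2 h1 h2 h3]
  obtain ⟨e1, e2, e3⟩ := edge_ne h1 h2 h3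
  rw [Finset.card_filter, Finset.sum_insert (by simp [e1, e2, -Sym2.eq_iff]),
    Finset.sum_insert (by simp [e3, -Sym2.eq_iff]), Finset.sum_singleton]
  unfold hh
  push_cast
  ring

lemma count_union (f : Sym2 V → Fin 8) (c : Fin 8) {T T' : Finset (Finset V)} {W W' : Finset V}
    (h : IsKrTilingOn G 3 T W) (h' : IsKrTilingOn G 3 T' W') (hd : Disjoint W W') :
    tilingColorCount f (T ∪ T') c = tilingColorCount f T c + tilingColorCount f T' c := by
  unfold tilingColorCount
  rw [Finset.sum_union (h.disj h' hd)]

lemma edge_count {T : Finset (Finset V)} {W : Finset V} (h : IsKrTilingOn G 3 T W) :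
    tilingEdgeCount T = W.card := by
  rw [h.card_eq]
  unfold tilingEdgeCount
  rw [Finset.sum_const_nat (m := 3), mul_comm]
  intro K hK
  obtain ⟨x, y, z, h1, h2, h3, rfl⟩ := SimpleGraph.is3Clique_iff.1 (h.1 K hK)
  rw [tri_sym2 h1.ne h2.ne h3.ne]
  obtain ⟨e1, e2, e3⟩ := edge_ne h1.ne h2.ne h3.ne
  rw [Finset.card_eq_three]
  exact ⟨_, _, _, e1, e2, e3, rfl⟩

lemma count_sum (f : Sym2 V → Fin 8) {T : Finset (Finset V)} {W : Finset V}
    (h : IsKrTilingOn G 3 T W) : ∑ c, tilingColorCount f T c = W.card := by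
  rw [← edge_count h]
  unfold tilingColorCount tilingEdgeCount
  rw [Finset.sum_comm]
  refine Finset.sum_congr rfl fun K hK => ?_
  rw [Finset.card_eq_sum_card_fiberwise (f := f) (t := Finset.univ) (fun _ _ => by simp)]
  simp only [Finset.filter_filter]

/-- Sum of `φ` over a tiling. -/
lemma count_phi (f : Sym2 V → Fin 8) (c : Fin 8) {T : Finset (Finset V)} {W : Finset V}
    (h : IsKrTilingOn G 3 T W) (φ : V → ℤ)
    (hφ : ∀ x ∈ W, ∀ y ∈ W, ∀ z ∈ W, G.Adj x y → G.Adj x z → G.Adj y z →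
      hh f c x y + hh f c x z + hh f c y z = φ x + φ y + φ z) :
    (tilingColorCount f T c : ℤ) = ∑ v ∈ W, φ v := by
  have hs : ∀ K ∈ T, K ⊆ W := fun K hK => h.sub hK
  rw [← h.2.2, Finset.sum_biUnion]
  · unfold tilingColorCount
    push_cast
    refine Finset.sum_congr rfl fun K hK => ?_
    obtain ⟨x, y, z, h1, h2, h3, rfl⟩ := SimpleGraph.is3Clique_iff.1 (h.1 K hK)
    have hxW := hs _ hK
    have := tri_wt f c h1.ne h2.ne h3.ne
    unfold tilingColorCount at this
    rw [Finset.sum_singleton] at this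
    rw [this, hφ x (hxW (by simp)) y (hxW (by simp)) z (hxW (by simp)) h1 h2 h3]
    simp only [id]
    rw [Finset.sum_insert (by simp [h1.ne, h2.ne]), Finset.sum_insert (by simp [h3.ne]),
      Finset.sum_singleton]
    ring
  · intro K hK K' hK' hne
    exact h.2.1 K hK K' hK' hne

end colour

section potential
variable [DecidableEq V] {G : SimpleGraph V} {f : Sym2 V → Fin 8} {W : Finset V}

/-- Colour weight of the triangle `xyz`. -/
def wt (f : Sym2 V → Fin 8) (c : Fin 8) (x y z : V) : ℤ := hh f c x y + hh f c x z + hh f c y z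

/-- All tilings of small subsets of `W` have the same colour counts. -/
def Rigid (G : SimpleGraph V) (f : Sym2 V → Fin 8) (W : Finset V) : Prop :=
  ∀ U ⊆ W, U.card ≤ 12 → ∀ T1 T2, IsKrTilingOn G 3 T1 U → IsKrTilingOn G 3 T2 U →
    ∀ c, tilingColorCount f T1 c = tilingColorCount f T2 c

/-- Any three vertices have many common neighbours. -/
def Rich (G : SimpleGraph V) (W : Finset V) : Prop :=
  ∀ a ∈ W, ∀ b ∈ W, ∀ c ∈ W, ∀ X : Finset V, X.card ≤ 30 →
    ∃ x ∈ W, x ∉ X ∧ G.Adj a x ∧ G.Adj b x ∧ G.Adj c x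

/-- Flatten a list of triples. -/
def flat (L : List (V × V × V)) : List V := L.flatMap fun p => [p.1, p.2.1, p.2.2]

/-- Triple is a triangle. -/
def IsTri (G : SimpleGraph V) (p : V × V × V) : Prop :=
  G.Adj p.1 p.2.1 ∧ G.Adj p.1 p.2.2 ∧ G.Adj p.2.1 p.2.2

lemma tileL (f : Sym2 V → Fin 8) (L : List (V × V × V)) (hn : (flat L).Nodup)
    (ht : ∀ p ∈ L, IsTri G p) :
    ∃ T, IsKrTilingOn G 3 T (flat L).toFinset ∧
      ∀ c, (tilingColorCount f T c : ℤ) = (L.map fun p => wt f c p.1 p.2.1 p.2.2).sum := by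
  induction L with
  | nil => exact ⟨∅, by simpa [flat] using IsKrTilingOn.empty, by simp [tilingColorCount]⟩
  | cons p L ih =>
    have e : flat (p :: L) = [p.1, p.2.1, p.2.2] ++ flat L := by simp [flat]
    rw [e] at hn ⊢
    rw [List.nodup_append'] at hn
    obtain ⟨T, hT, hc⟩ := ih hn.2.1 (fun q hq => ht q (by simp [hq]))
    obtain ⟨h1, h2, h3⟩ := ht p (by simp)
    have hd : Disjoint ({p.1, p.2.1, p.2.2} : Finset V) (flat L).toFinset := by
      rw [Finset.disjoint_left]
      intro a ha hb
      exact hn.2.2 (by simpa using ha) (List.mem_toFinset.1 hb)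
    refine ⟨{{p.1, p.2.1, p.2.2}} ∪ T, ?_, ?_⟩
    · have := (IsKrTilingOn.single h1 h2 h3).union hT hd
      rw [List.toFinset_append]
      simpa using this
    · intro c
      rw [count_union f c (IsKrTilingOn.single h1 h2 h3) hT hd]
      push_cast
      rw [tri_wt f c h1.ne h2.ne h3.ne, hc]
      simp [wt]

lemma Rigid.list (h : Rigid G f W) (L1 L2 : List (V × V × V)) (hn : (flat L1).Nodup)
    (hp : (flat L1 : Multiset V) = (flat L2 : Multiset V)) (h1 : ∀ p ∈ L1, IsTri G p)
    (h2 : ∀ p ∈ L2, IsTri G p) (hW : ∀ x ∈ flat L1, x ∈ W) (hl : (flat L1).length ≤ 12)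
    (c : Fin 8) :
    (L1.map fun p => wt f c p.1 p.2.1 p.2.2).sum = (L2.map fun p => wt f c p.1 p.2.1 p.2.2).sum := by
  have hp' := Multiset.coe_eq_coe.1 hp
  have hn2 := hp'.nodup_iff.1 hn
  obtain ⟨T1, hT1, c1⟩ := tileL f L1 hn h1
  obtain ⟨T2, hT2, c2⟩ := tileL f L2 hn2 h2
  rw [← List.toFinset_eq_of_perm _ _ hp'] at hT2
  rw [← c1, ← c2]
  have := h _ (fun x hx => hW x (List.mem_toFinset.1 hx)) ((List.toFinset_card_le _).trans hl)
    T1 T2 hT1 hT2 c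
  exact_mod_cast this

/-- The edge `xy` lies in the common neighbourhood of `u` and `v`. -/
def Lk (G : SimpleGraph V) (W : Finset V) (u v x y : V) : Prop :=
  x ∈ W ∧ y ∈ W ∧ G.Adj u x ∧ G.Adj u y ∧ G.Adj v x ∧ G.Adj v y ∧ G.Adj x y

lemma Rich.lk (h : Rich G W) {u v : V} (hu : u ∈ W) (hv : v ∈ W) (X : Finset V) (hX : X.card ≤ 30) :
    ∃ x y, Lk G W u v x y ∧ x ∉ X ∧ y ∉ X := by
  obtain ⟨x, hx, hxX, h1, h2, -⟩ := h u hu v hv v hv X hX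
  obtain ⟨y, hy, hyX, h3, h4, h5⟩ := h u hu v hv x hx X hX
  exact ⟨x, y, ⟨hx, hy, h1, h3, h2, h4, h5⟩, hxX, hyX⟩

lemma card6 (a b c d e g : V) : ({a, b, c, d, e, g} : Finset V).card ≤ 6 := Finset.card_le_six

lemma Rigid.ind (hr : Rigid G f W) (h : Rich G W) {u v x y x' y' : V} (hu : u ∈ W) (hv : v ∈ W)
    (h1 : Lk G W u v x y) (h2 : Lk G W u v x' y') (c : Fin 8) :
    wt f c u x y - wt f c v x y = wt f c u x' y' - wt f c v x' y' := by
  by_cases huv : u = v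
  · subst huv; simp
  have key : ∀ x y x' y', Lk G W u v x y → Lk G W u v x' y' → x' ∉ ({x, y} : Finset V) →
      y' ∉ ({x, y} : Finset V) → wt f c u x y - wt f c v x y = wt f c u x' y' - wt f c v x' y' := by
    intro x y x' y' h1 h2 hx hy
    obtain ⟨a1, a2, a3, a4, a5, a6, a7⟩ := h1
    obtain ⟨b1, b2, b3, b4, b5, b6, b7⟩ := h2
    have := hr.list [(u, x, y), (v, x', y')] [(v, x, y), (u, x', y')] (by
      have := a3.ne; have := a4.ne; have := a5.ne; have := a6.ne; have := a7.ne
      have := b3.ne; have := b4.ne; have := b5.ne; have := b6.ne; have := b7.ne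
      simp only [mem_insert, mem_singleton] at hx hy
      simp [flat]
      grind) (by
      simp only [flat, List.flatMap_cons, List.flatMap_nil, List.cons_append, List.nil_append,
        ← Multiset.cons_coe, Multiset.coe_nil, ← Multiset.singleton_add]
      abel) (by simp [IsTri]; tauto) (by simp [IsTri]; tauto) (by simp [flat]; tauto)
      (by simp [flat]) c
    simp at this
    linarith
  obtain ⟨p, q, hpq, hp, hq⟩ := h.lk hu hv ({x, y, x', y'} : Finset V)
    (Finset.card_le_four.trans (by norm_num))
  rw [key x y p q h1 hpq (by simp at hp ⊢; tauto) (by simp at hq ⊢; tauto),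
    key x' y' p q h2 hpq (by simp at hp ⊢; tauto) (by simp at hq ⊢; tauto)]

lemma Rigid.nine (hr : Rigid G f W) {u v t x y x' y' x'' y'' : V} (hu : u ∈ W) (hv : v ∈ W)
    (ht : t ∈ W) (h1 : Lk G W u v x y) (h2 : Lk G W v t x' y') (h3 : Lk G W t u x'' y'')
    (huv : u ≠ v) (hvt : v ≠ t) (hut : u ≠ t)
    (hx : x ≠ t) (hy : y ≠ t) (hx' : x' ∉ ({u, x, y} : Finset V)) (hy' : y' ∉ ({u, x, y} : Finset V))
    (hx'' : x'' ∉ ({v, x, y, x', y'} : Finset V)) (hy'' : y'' ∉ ({v, x, y, x', y'} : Finset V))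
    (c : Fin 8) :
    (wt f c u x y - wt f c v x y) + (wt f c v x' y' - wt f c t x' y') +
      (wt f c t x'' y'' - wt f c u x'' y'') = 0 := by
  obtain ⟨a1, a2, a3, a4, a5, a6, a7⟩ := h1
  obtain ⟨b1, b2, b3, b4, b5, b6, b7⟩ := h2
  obtain ⟨d1, d2, d3, d4, d5, d6, d7⟩ := h3
  have := hr.list [(u, x, y), (v, x', y'), (t, x'', y'')] [(v, x, y), (t, x', y'), (u, x'', y'')] (by
    have := a3.ne; have := a4.ne; have := a5.ne; have := a6.ne; have := a7.ne
    have := b3.ne; have := b4.ne; have := b5.ne; have := b6.ne; have := b7.ne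
    have := d3.ne; have := d4.ne; have := d5.ne; have := d6.ne; have := d7.ne
    simp only [mem_insert, mem_singleton] at hx' hy' hx'' hy''
    simp [flat]
    grind) (by
    simp only [flat, List.flatMap_cons, List.flatMap_nil, List.cons_append, List.nil_append,
      ← Multiset.cons_coe, Multiset.coe_nil, ← Multiset.singleton_add]
    abel) (by simp [IsTri]; tauto) (by simp [IsTri]; tauto) (by simp [flat]; tauto)
    (by simp [flat]) c
  simp at this
  linarith

lemma Rigid.twelve (hr : Rigid G f W) {a1 a2 a3 b1 b2 b3 x1 y1 x2 y2 x3 y3 : V}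
    (ha1 : a1 ∈ W) (ha2 : a2 ∈ W) (ha3 : a3 ∈ W) (hb1 : b1 ∈ W) (hb2 : b2 ∈ W) (hb3 : b3 ∈ W)
    (ta : IsTri G (a1, a2, a3)) (tb : IsTri G (b1, b2, b3))
    (n1 : b1 ∉ ({a1, a2, a3} : Finset V)) (n2 : b2 ∉ ({a1, a2, a3} : Finset V))
    (n3 : b3 ∉ ({a1, a2, a3} : Finset V))
    (h1 : Lk G W a1 b1 x1 y1) (h2 : Lk G W a2 b2 x2 y2) (h3 : Lk G W a3 b3 x3 y3)
    (k1 : x1 ∉ ({a1, a2, a3, b1, b2, b3} : Finset V)) (l1 : y1 ∉ ({a1, a2, a3, b1, b2, b3} : Finset V))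
    (k2 : x2 ∉ ({a1, a2, a3, b1, b2, b3, x1, y1} : Finset V))
    (l2 : y2 ∉ ({a1, a2, a3, b1, b2, b3, x1, y1} : Finset V))
    (k3 : x3 ∉ ({a1, a2, a3, b1, b2, b3, x1, y1, x2, y2} : Finset V))
    (l3 : y3 ∉ ({a1, a2, a3, b1, b2, b3, x1, y1, x2, y2} : Finset V)) (c : Fin 8) :
    wt f c a1 a2 a3 - wt f c b1 b2 b3 = (wt f c a1 x1 y1 - wt f c b1 x1 y1) +
      (wt f c a2 x2 y2 - wt f c b2 x2 y2) + (wt f c a3 x3 y3 - wt f c b3 x3 y3) := by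
  obtain ⟨p1, p2, p3, p4, p5, p6, p7⟩ := h1
  obtain ⟨q1, q2, q3, q4, q5, q6, q7⟩ := h2
  obtain ⟨d1, d2, d3, d4, d5, d6, d7⟩ := h3
  obtain ⟨s1, s2, s3⟩ := ta
  obtain ⟨r1, r2, r3⟩ := tb
  simp only at s1 s2 s3 r1 r2 r3
  have := hr.list [(a1, a2, a3), (b1, x1, y1), (b2, x2, y2), (b3, x3, y3)]
      [(b1, b2, b3), (a1, x1, y1), (a2, x2, y2), (a3, x3, y3)] (by
    have := p7.ne; have := q7.ne; have := d7.ne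
    have := s1.ne; have := s2.ne; have := s3.ne; have := r1.ne; have := r2.ne; have := r3.ne
    simp only [mem_insert, mem_singleton, not_or] at n1 n2 n3 k1 k2 k3 l1 l2 l3
    simp [flat]
    grind) (by
    simp only [flat, List.flatMap_cons, List.flatMap_nil, List.cons_append, List.nil_append,
      ← Multiset.cons_coe, Multiset.coe_nil, ← Multiset.singleton_add]
    abel) (by simp [IsTri]; tauto) (by simp [IsTri]; tauto) (by simp [flat]; tauto)
    (by simp [flat]) c
  simp at this
  linarith
end potential

section potential2
variable [DecidableEq V] {G : SimpleGraph V} {f : Sym2 V → Fin 8} {W : Finset V}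

lemma Lk.symm {u v x y : V} (h : Lk G W u v x y) : Lk G W v u x y := by
  obtain ⟨p1, p2, p3, p4, p5, p6, p7⟩ := h
  exact ⟨p1, p2, p5, p6, p3, p4, p7⟩

lemma card_le_eight (a b c d e g i j : V) : ({a, b, c, d, e, g, i, j} : Finset V).card ≤ 30 := by
  refine (Finset.card_insert_le _ _).trans ?_
  have := (Finset.card_insert_le b ({c, d, e, g, i, j} : Finset V))
  have := card6 c d e g i j
  omega

lemma card_le_ten (a b c d e g i j k l : V) :
    ({a, b, c, d, e, g, i, j, k, l} : Finset V).card ≤ 30 := by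
  have h1 := (Finset.card_insert_le a ({b, c, d, e, g, i, j, k, l} : Finset V))
  have h2 := (Finset.card_insert_le b ({c, d, e, g, i, j, k, l} : Finset V))
  have h3 := (Finset.card_insert_le c ({d, e, g, i, j, k, l} : Finset V))
  have h4 := (Finset.card_insert_le d ({e, g, i, j, k, l} : Finset V))
  have := card6 e g i j k l
  omega

lemma Rigid.phi (hr : Rigid G f W) (h : Rich G W) {a : V} (ha : a ∈ W) (c : Fin 8) :
    ∃ φ : V → ℤ, φ a = 0 ∧ ∀ u ∈ W, ∀ v ∈ W, ∀ x y, Lk G W u v x y →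
      wt f c u x y - wt f c v x y = φ u - φ v := by
  have hex : ∀ v, ∃ k : ℤ, v ∈ W → ∀ x y, Lk G W v a x y → wt f c v x y - wt f c a x y = k := by
    intro v
    by_cases hv : v ∈ W
    · obtain ⟨x, y, hxy, -, -⟩ := h.lk hv ha ∅ (by simp)
      exact ⟨_, fun _ x' y' h' => hr.ind h hv ha h' hxy c⟩
    · exact ⟨0, fun hv' => absurd hv' hv⟩
  choose φ hφ using hex
  have h0 : φ a = 0 := by
    obtain ⟨x, y, hxy, -, -⟩ := h.lk ha ha ∅ (by simp)
    rw [← hφ a ha x y hxy]; ring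
  refine ⟨φ, h0, ?_⟩
  intro u hu v hv x y hxy
  by_cases huv : u = v
  · subst huv; simp
  by_cases hva : v = a
  · subst hva; rw [h0, hφ u hu x y hxy]; simp
  by_cases hua : u = a
  · subst hua
    have := hφ v hv x y hxy.symm
    rw [h0]; linarith
  obtain ⟨x1, y1, h1, k1, l1⟩ := h.lk hu hv {a} (by simp)
  obtain ⟨x2, y2, h2, k2, l2⟩ := h.lk hv ha {u, x1, y1} (Finset.card_le_three.trans (by norm_num))
  obtain ⟨x3, y3, h3, k3, l3⟩ := h.lk ha hu {v, x1, y1, x2, y2}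
    (Finset.card_le_five.trans (by norm_num))
  have := hr.nine hu hv ha h1 h2 h3 huv hva hua (by simpa using k1) (by simpa using l1) k2 l2 k3 l3 c
  rw [hr.ind h hu hv hxy h1 c]
  have e1 := hφ u hu x3 y3 h3.symm
  have e2 := hφ v hv x2 y2 h2
  linarith

lemma Rigid.tri_diff (hr : Rigid G f W) (h : Rich G W) (c : Fin 8) (φ : V → ℤ)
    (hφ : ∀ u ∈ W, ∀ v ∈ W, ∀ x y, Lk G W u v x y →
      wt f c u x y - wt f c v x y = φ u - φ v) {a1 a2 a3 b1 b2 b3 : V}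
    (ha1 : a1 ∈ W) (ha2 : a2 ∈ W) (ha3 : a3 ∈ W) (hb1 : b1 ∈ W) (hb2 : b2 ∈ W) (hb3 : b3 ∈ W)
    (ta : IsTri G (a1, a2, a3)) (tb : IsTri G (b1, b2, b3)) :
    wt f c a1 a2 a3 - (φ a1 + φ a2 + φ a3) = wt f c b1 b2 b3 - (φ b1 + φ b2 + φ b3) := by
  have key : ∀ {a1 a2 a3 b1 b2 b3 : V}, a1 ∈ W → a2 ∈ W → a3 ∈ W → b1 ∈ W → b2 ∈ W → b3 ∈ W →
      IsTri G (a1, a2, a3) → IsTri G (b1, b2, b3) → b1 ∉ ({a1, a2, a3} : Finset V) →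
      b2 ∉ ({a1, a2, a3} : Finset V) → b3 ∉ ({a1, a2, a3} : Finset V) →
      wt f c a1 a2 a3 - (φ a1 + φ a2 + φ a3) = wt f c b1 b2 b3 - (φ b1 + φ b2 + φ b3) := by
    intro a1 a2 a3 b1 b2 b3 ha1 ha2 ha3 hb1 hb2 hb3 ta tb n1 n2 n3
    obtain ⟨x1, y1, h1, k1, l1⟩ := h.lk ha1 hb1 {a1, a2, a3, b1, b2, b3}
      (Finset.card_le_six.trans (by norm_num))
    obtain ⟨x2, y2, h2, k2, l2⟩ := h.lk ha2 hb2 {a1, a2, a3, b1, b2, b3, x1, y1}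
      (card_le_eight _ _ _ _ _ _ _ _)
    obtain ⟨x3, y3, h3, k3, l3⟩ := h.lk ha3 hb3 {a1, a2, a3, b1, b2, b3, x1, y1, x2, y2}
      (card_le_ten _ _ _ _ _ _ _ _ _ _)
    have := hr.twelve ha1 ha2 ha3 hb1 hb2 hb3 ta tb n1 n2 n3 h1 h2 h3 k1 l1 k2 l2 k3 l3 c
    rw [hφ a1 ha1 b1 hb1 _ _ h1, hφ a2 ha2 b2 hb2 _ _ h2, hφ a3 ha3 b3 hb3 _ _ h3] at this
    linarith
  obtain ⟨x, hx, nx, -⟩ := h a1 ha1 a1 ha1 a1 ha1 {a1, a2, a3, b1, b2, b3}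
    (Finset.card_le_six.trans (by norm_num))
  obtain ⟨y, z, hyz, ny, nz⟩ := h.lk hx hx {a1, a2, a3, b1, b2, b3}
    (Finset.card_le_six.trans (by norm_num))
  obtain ⟨q1, q2, q3, q4, q5, q6, q7⟩ := hyz
  simp only [mem_insert, mem_singleton, not_or] at nx ny nz
  rw [key ha1 ha2 ha3 hx q1 q2 ta ⟨q3, q4, q7⟩ (by simp; tauto) (by simp; tauto) (by simp; tauto),
    key hb1 hb2 hb3 hx q1 q2 tb ⟨q3, q4, q7⟩ (by simp; tauto) (by simp; tauto) (by simp; tauto)]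

/-- `φ` is a vertex potential for the colour `c`. -/
def IsPot (G : SimpleGraph V) (f : Sym2 V → Fin 8) (W : Finset V) (c : Fin 8) (φ : V → ℤ) : Prop :=
  ∀ x ∈ W, ∀ y ∈ W, ∀ z ∈ W, G.Adj x y → G.Adj x z → G.Adj y z →
      hh f c x y + hh f c x z + hh f c y z = φ x + φ y + φ z

/-- `K₄` -/
def IsQ (G : SimpleGraph V) (W : Finset V) (p q r s : V) : Prop :=
  p ∈ W ∧ q ∈ W ∧ r ∈ W ∧ s ∈ W ∧ G.Adj p q ∧ G.Adj p r ∧ G.Adj p s ∧ G.Adj q r ∧ G.Adj q s ∧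
    G.Adj r s

lemma Rigid.pot (hr : Rigid G f W) (h : Rich G W) {p q r s : V} (hQ : IsQ G W p q r s) {c : Fin 8}
    (h1 : f s(p, q) ≠ c) (h2 : f s(p, r) ≠ c) (h3 : f s(p, s) ≠ c) (h4 : f s(q, r) ≠ c)
    (h5 : f s(q, s) ≠ c) (h6 : f s(r, s) ≠ c) :
    ∃ φ, IsPot G f W c φ ∧ φ p = 0 ∧ φ q = 0 ∧ φ r = 0 ∧ φ s = 0 := by
  obtain ⟨hp, hq, hr', hs, a1, a2, a3, a4, a5, a6⟩ := hQ
  obtain ⟨φ, h0, hφ⟩ := hr.phi h hp c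
  have e1 := hr.tri_diff h c φ hφ hp hq hr' hp hq hs ⟨a1, a2, a4⟩ ⟨a1, a3, a5⟩
  have e2 := hr.tri_diff h c φ hφ hp hq hr' hp hr' hs ⟨a1, a2, a4⟩ ⟨a2, a3, a6⟩
  have e3 := hr.tri_diff h c φ hφ hp hq hr' hq hr' hs ⟨a1, a2, a4⟩ ⟨a4, a5, a6⟩
  simp only [wt, hh, h1, h2, h3, h4, h5, h6, if_false] at e1 e2 e3
  refine ⟨φ, ?_, h0, by linarith, by linarith, by linarith⟩
  intro x hx y hy z hz b1 b2 b3
  have e := hr.tri_diff h c φ hφ hx hy hz hp hq hr' ⟨b1, b2, b3⟩ ⟨a1, a2, a4⟩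
  have e' : wt f c p q r = 0 := by simp [wt, hh, h1, h2, h4]
  rw [e'] at e
  have : wt f c x y z = hh f c x y + hh f c x z + hh f c y z := rfl
  linarith
end potential2

section parity
variable [DecidableEq V] {G : SimpleGraph V} [DecidableRel G.Adj] {f : Sym2 V → Fin 8} {W : Finset V}

lemma IsPot.k4 {c : Fin 8} {φ : V → ℤ} (hφ : IsPot G f W c φ) {p q r s : V} (hQ : IsQ G W p q r s) :
    (φ p + φ q + φ r + φ s) % 2 = 0 ∧ (φ p % 2 = 0 → φ q % 2 = 1 → φ q = 1) ∧
      (φ p % 2 = 0 → φ p = 0 ∨ φ p = 2) := by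
  obtain ⟨hp, hq, hr, hs, a1, a2, a3, a4, a5, a6⟩ := hQ
  have e1 := hφ p hp q hq r hr a1 a2 a4
  have e2 := hφ p hp q hq s hs a1 a3 a5
  have e3 := hφ p hp r hr s hs a2 a3 a6
  have e4 := hφ q hq r hr s hs a4 a5 a6
  have h1 := hh_cases f c p q
  have h2 := hh_cases f c p r
  have h3 := hh_cases f c p s
  have h4 := hh_cases f c q r
  have h5 := hh_cases f c q s
  have h6 := hh_cases f c r s
  refine ⟨?_, ?_, ?_⟩ <;> omega

lemma indep_le {S : Finset V} (hS : S ⊆ W) {v : V} (hv : ∀ w ∈ S, ¬ G.Adj v w) :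
    dg G W v + S.card ≤ W.card := by
  rw [dg, ← Finset.card_union_of_disjoint]
  · exact Finset.card_le_card (Finset.union_subset (Finset.filter_subset _ _) hS)
  · rw [Finset.disjoint_left]
    intro a ha hb
    exact hv a hb (Finset.mem_filter.1 ha).2

lemma Rich.k4 (h : Rich G W) {p q : V} (hp : p ∈ W) (hq : q ∈ W) (hpq : G.Adj p q) :
    ∃ r s, IsQ G W p q r s := by
  obtain ⟨r, s, ⟨a1, a2, a3, a4, a5, a6, a7⟩, -, -⟩ := h.lk hp hq ∅ (by simp)
  exact ⟨r, s, hp, hq, a1, a2, hpq, a3, a4, a5, a6, a7⟩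

lemma Rich.k4' (h : Rich G W) {p : V} (hp : p ∈ W) :
    ∃ q r s, IsQ G W p q r s := by
  obtain ⟨q, hq, -, hpq, -⟩ := h p hp p hp p hp ∅ (by simp)
  obtain ⟨r, s, hh⟩ := h.k4 hp hq hpq
  exact ⟨q, r, s, hh⟩

lemma common_lb (x y : V) : dg G W x + dg G W y ≤
    W.card + (W.filter fun z => G.Adj x z ∧ G.Adj y z).card := by
  have h1 := Finset.card_union_add_card_inter (W.filter (G.Adj x)) (W.filter (G.Adj y))
  have h2 : (W.filter (G.Adj x) ∪ W.filter (G.Adj y)).card ≤ W.card :=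
    Finset.card_le_card (Finset.union_subset (Finset.filter_subset _ _) (Finset.filter_subset _ _))
  rw [← Finset.filter_and] at h1
  unfold dg
  omega

/-- Common neighbourhood of an even-odd edge contains many odd vertices. -/
lemma IsPot.eo {c : Fin 8} {φ : V → ℤ} (hφ : IsPot G f W c φ) {κ : ℝ}
    (hdeg : ∀ v ∈ W, (11 / 16 + κ) * W.card ≤ dg G W v) {x o : V} (hx : x ∈ W) (ho : o ∈ W)
    (hxe : φ x % 2 = 0) (hoo : φ o % 2 = 1) (hxo : G.Adj x o) :
    (1 / 16 + 3 * κ) * W.card ≤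
      (W.filter fun z => (G.Adj x z ∧ G.Adj o z) ∧ φ z % 2 = 1).card := by
  have h1 := common_lb (G := G) (W := W) x o
  have h1' : (dg G W x : ℝ) + dg G W o ≤
    W.card + (W.filter fun z => G.Adj x z ∧ G.Adj o z).card := by exact_mod_cast h1
  have h2 := Finset.card_filter_add_card_filter_not (s := W.filter fun z => G.Adj x z ∧ G.Adj o z)
    (fun z => φ z % 2 = 1)
  rw [Finset.filter_filter, Finset.filter_filter] at h2
  have h2' : ((W.filter fun z => (G.Adj x z ∧ G.Adj o z) ∧ φ z % 2 = 1).card : ℝ) +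
    (W.filter fun z => (G.Adj x z ∧ G.Adj o z) ∧ ¬ φ z % 2 = 1).card =
    (W.filter fun z => G.Adj x z ∧ G.Adj o z).card := by exact_mod_cast h2
  have d1 := hdeg x hx
  have d2 := hdeg o ho
  have h3 : ((W.filter fun z => (G.Adj x z ∧ G.Adj o z) ∧ ¬ φ z % 2 = 1).card : ℝ) ≤
      (5 / 16 - κ) * W.card := by
    rcases (W.filter fun z => (G.Adj x z ∧ G.Adj o z) ∧ ¬ φ z % 2 = 1).eq_empty_or_nonempty with
      he | ⟨y, hy⟩
    · rw [he, Finset.card_empty]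
      have : (dg G W x : ℝ) ≤ W.card := by
        exact_mod_cast Finset.card_filter_le _ _
      push_cast
      linarith
    · rw [Finset.mem_filter] at hy
      obtain ⟨hyW, ⟨hxy, hoy⟩, hye⟩ := hy
      have := indep_le (G := G) (W := W) (S := (W.filter fun z => (G.Adj x z ∧ G.Adj o z) ∧ ¬ φ z % 2 = 1))
        (v := y) (Finset.filter_subset _ _) (by
          intro z hz hyz
          rw [Finset.mem_filter] at hz
          obtain ⟨hzW, ⟨hxz, hoz⟩, hze⟩ := hz
          have := (hφ.k4 (p := x) (q := o) (r := y) (s := z)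
            ⟨hx, ho, hyW, hzW, hxo, hxy, hxz, hoy, hoz, hyz⟩).1
          omega)
      have h5 : (dg G W y : ℝ) + (W.filter fun z => (G.Adj x z ∧ G.Adj o z) ∧ ¬ φ z % 2 = 1).card ≤
        W.card := by exact_mod_cast this
      have := hdeg y hyW
      linarith
  linarith

lemma IsPot.odd_le {c : Fin 8} {φ : V → ℤ} (hφ : IsPot G f W c φ) {κ : ℝ}
    (hdeg : ∀ v ∈ W, (11 / 16 + κ) * W.card ≤ dg G W v) {p q r s : V} (hQ : IsQ G W p q r s)
    (hp : φ p = 0) (hq : φ q = 0) (hr : φ r = 0) (hs : φ s = 0) :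
    2 * ((W.filter fun z => φ z % 2 = 1).card : ℝ) ≤ (20 / 16 - 4 * κ) * W.card := by
  have hQ' := hQ
  obtain ⟨hpW, hqW, hrW, hsW, a1, a2, a3, a4, a5, a6⟩ := hQ'
  have key : dg G W p + dg G W q + dg G W r + dg G W s + 2 * (W.filter fun z => φ z % 2 = 1).card
      ≤ 4 * W.card := by
    unfold dg
    simp only [Finset.card_filter]
    rw [← Finset.sum_add_distrib, ← Finset.sum_add_distrib, ← Finset.sum_add_distrib,
      Finset.mul_sum, ← Finset.sum_add_distrib]
    have : ∀ w ∈ W, ((((if G.Adj p w then 1 else 0) + if G.Adj q w then 1 else 0) +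
        if G.Adj r w then 1 else 0) + if G.Adj s w then 1 else 0) +
        2 * (if φ w % 2 = 1 then 1 else 0) ≤ 4 := by
      intro w hw
      by_cases ho : φ w % 2 = 1
      · have k1 : G.Adj p w → G.Adj q w → G.Adj r w → False := fun b1 b2 b3 => by
          have := (hφ.k4 (p := p) (q := q) (r := r) (s := w)
            ⟨hpW, hqW, hrW, hw, a1, a2, b1, a4, b2, b3⟩).1
          omega
        have k2 : G.Adj p w → G.Adj q w → G.Adj s w → False := fun b1 b2 b3 => by
          have := (hφ.k4 (p := p) (q := q) (r := s) (s := w)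
            ⟨hpW, hqW, hsW, hw, a1, a3, b1, a5, b2, b3⟩).1
          omega
        have k3 : G.Adj p w → G.Adj r w → G.Adj s w → False := fun b1 b2 b3 => by
          have := (hφ.k4 (p := p) (q := r) (r := s) (s := w)
            ⟨hpW, hrW, hsW, hw, a2, a3, b1, a6, b2, b3⟩).1
          omega
        have k4 : G.Adj q w → G.Adj r w → G.Adj s w → False := fun b1 b2 b3 => by
          have := (hφ.k4 (p := q) (q := r) (r := s) (s := w)
            ⟨hqW, hrW, hsW, hw, a4, a5, b1, a6, b2, b3⟩).1
          omega
        rw [if_pos ho]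
        split_ifs <;> first | omega | tauto
      · rw [if_neg ho]
        split_ifs <;> omega
    have h2 := Finset.sum_le_sum this
    rw [Finset.sum_const, smul_eq_mul, mul_comm] at h2
    exact h2
  have key' : (dg G W p : ℝ) + dg G W q + dg G W r + dg G W s +
    2 * (W.filter fun z => φ z % 2 = 1).card ≤ 4 * W.card := by exact_mod_cast key
  have := hdeg p hpW
  have := hdeg q hqW
  have := hdeg r hrW
  have := hdeg s hsW
  linarith

lemma IsPot.star {c : Fin 8} {φ : V → ℤ} (hφ : IsPot G f W c φ) (hR : Rich G W) {κ : ℝ} (hκ : 0 < κ)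
    (hdeg : ∀ v ∈ W, (11 / 16 + κ) * W.card ≤ dg G W v) {p q r s : V} (hQ : IsQ G W p q r s)
    (hp : φ p = 0) (hq : φ q = 0) (hr : φ r = 0) (hs : φ s = 0)
    (hsum : ((∑ v ∈ W, φ v : ℤ) : ℝ) ≤ (1 / 8 + κ) * W.card) :
    ∀ v ∈ W, φ v = 0 ∨ φ v = 2 := by
  have hmpos : (0 : ℝ) < W.card := by
    exact_mod_cast Finset.card_pos.2 ⟨p, hQ.1⟩
  have hE : ∀ v ∈ W, φ v % 2 = 0 → φ v = 0 ∨ φ v = 2 := by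
    intro v hv he
    obtain ⟨a, b, d, h⟩ := hR.k4' hv
    exact (hφ.k4 h).2.2 he
  by_cases hO : ∀ v ∈ W, φ v % 2 = 0
  · exact fun v hv => hE v hv (hO v hv)
  exfalso
  push Not at hO
  obtain ⟨o, ho, hodd⟩ := hO
  have hodd : φ o % 2 = 1 := by omega
  have hle := hφ.odd_le hdeg hQ hp hq hr hs
  -- odd vertices have an even neighbour
  have hen : ∀ o ∈ W, φ o % 2 = 1 → ∃ x ∈ W, φ x % 2 = 0 ∧ G.Adj x o := by
    intro o ho hodd
    by_contra hcon
    push Not at hcon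
    have hsub : W.filter (G.Adj o) ⊆ W.filter fun z => φ z % 2 = 1 := by
      intro z hz
      rw [Finset.mem_filter] at hz ⊢
      refine ⟨hz.1, ?_⟩
      by_contra hne
      exact hcon z hz.1 (by omega) hz.2.symm
    have h1 : (dg G W o : ℝ) ≤ (W.filter fun z => φ z % 2 = 1).card := by
      exact_mod_cast Finset.card_le_card hsub
    have h2 := hdeg o ho
    have : 0 < κ * W.card := by positivity
    linarith
  have hO1 : ∀ o ∈ W, φ o % 2 = 1 → φ o = 1 := by
    intro o ho hodd
    obtain ⟨x, hx, hxe, hxo⟩ := hen o ho hodd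
    obtain ⟨a, b, h⟩ := hR.k4 hx ho hxo
    exact (hφ.k4 h).2.1 hxe hodd
  have hsumlb : ((W.filter fun z => φ z % 2 = 1).card : ℤ) ≤ ∑ v ∈ W, φ v := by
    rw [Finset.card_filter]
    push_cast
    apply Finset.sum_le_sum
    intro v hv
    split_ifs with hv1
    · rw [hO1 v hv hv1]
    · rcases hE v hv (by omega) with h | h <;> omega
  have hsumlb' : ((W.filter fun z => φ z % 2 = 1).card : ℝ) ≤ ((∑ v ∈ W, φ v : ℤ) : ℝ) := by
    exact_mod_cast hsumlb
  obtain ⟨x, hx, hxe, hxo⟩ := hen o ho hodd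
  have hR1 := hφ.eo hdeg hx ho hxe hodd hxo
  have hpos : (0 : ℝ) < (W.filter fun z => (G.Adj x z ∧ G.Adj o z) ∧ φ z % 2 = 1).card :=
    lt_of_lt_of_le (by positivity) hR1
  obtain ⟨w, hw⟩ := Finset.card_pos.1 (by exact_mod_cast hpos)
  rw [Finset.mem_filter] at hw
  obtain ⟨hwW, ⟨hxw, how⟩, hwo⟩ := hw
  have hR2 := hφ.eo hdeg hx hwW hxe hwo hxw
  have hdis : Disjoint (W.filter fun z => (G.Adj x z ∧ G.Adj o z) ∧ φ z % 2 = 1)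
      (W.filter fun z => (G.Adj x z ∧ G.Adj w z) ∧ φ z % 2 = 1) := by
    rw [Finset.disjoint_left]
    intro z hz hz'
    rw [Finset.mem_filter] at hz hz'
    have := (hφ.k4 (p := x) (q := o) (r := w) (s := z)
      ⟨hx, ho, hwW, hz.1, hxo, hxw, hz.2.1.1, how, hz.2.1.2, hz'.2.1.2⟩).1
    have := hz.2.2
    omega
  have hcard := Finset.card_le_card (Finset.union_subset
    (show (W.filter fun z => (G.Adj x z ∧ G.Adj o z) ∧ φ z % 2 = 1) ⊆ W.filter fun z => φ z % 2 = 1 from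
      fun z hz => by rw [Finset.mem_filter] at hz ⊢; exact ⟨hz.1, hz.2.2⟩)
    (show (W.filter fun z => (G.Adj x z ∧ G.Adj w z) ∧ φ z % 2 = 1) ⊆ W.filter fun z => φ z % 2 = 1 from
      fun z hz => by rw [Finset.mem_filter] at hz ⊢; exact ⟨hz.1, hz.2.2⟩))
  rw [Finset.card_union_of_disjoint hdis] at hcard
  have hcard' : ((W.filter fun z => (G.Adj x z ∧ G.Adj o z) ∧ φ z % 2 = 1).card : ℝ) +
    (W.filter fun z => (G.Adj x z ∧ G.Adj w z) ∧ φ z % 2 = 1).card ≤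
    (W.filter fun z => φ z % 2 = 1).card := by exact_mod_cast hcard
  have : 0 < κ * W.card := by positivity
  linarith
end parity

section finish
variable [DecidableEq V] {G : SimpleGraph V} [DecidableRel G.Adj] {f : Sym2 V → Fin 8} {W : Finset V}

lemma rich_of_deg (hdeg : ∀ v ∈ W, 11 * W.card ≤ 16 * dg G W v) (hW : 480 < W.card) : Rich G W := by
  intro a ha b hb c hc X hX
  have := cn3 hdeg (A := W \ X) (j := 10) (by
    refine (Finset.card_le_card (t := X) ?_).trans hX
    intro x hx
    simp only [mem_sdiff] at hx
    tauto) ha hb hc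
  have hpos : 0 < ((W \ X).filter fun x => G.Adj a x ∧ G.Adj b x ∧ G.Adj c x).card := by omega
  obtain ⟨x, hx⟩ := Finset.card_pos.1 hpos
  simp only [mem_filter, mem_sdiff] at hx
  exact ⟨x, hx.1.1, hx.1.2, hx.2⟩

lemma hh_two (f : Sym2 V → Fin 8) {c d : Fin 8} (hcd : c ≠ d) (x y : V) :
    hh f c x y + hh f d x y ≤ 1 := by
  unfold hh
  split_ifs with h1 h2
  · exact absurd (h1.symm.trans h2) hcd
  all_goals simp

/-- `φ` is a potential with values in `{0, 2}`. -/
def IsStar (G : SimpleGraph V) (f : Sym2 V → Fin 8) (W : Finset V) (c : Fin 8) (φ : V → ℤ) : Prop :=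
  IsPot G f W c φ ∧ ∀ v ∈ W, φ v = 0 ∨ φ v = 2

lemma IsStar.tri {c d : Fin 8} {φ ψ : V → ℤ} (h : IsStar G f W c φ) (h' : IsStar G f W d ψ)
    (hcd : c ≠ d) {x y z : V} (hx : x ∈ W) (hy : y ∈ W) (hz : z ∈ W) (a1 : G.Adj x y)
    (a2 : G.Adj x z) (a3 : G.Adj y z) : φ x + φ y + φ z + (ψ x + ψ y + ψ z) ≤ 3 := by
  rw [← h.1 x hx y hy z hz a1 a2 a3, ← h'.1 x hx y hy z hz a1 a2 a3]
  have := hh_two f hcd x y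
  have := hh_two f hcd x z
  have := hh_two f hcd y z
  linarith

lemma IsStar.card {c : Fin 8} {φ : V → ℤ} (h : IsStar G f W c φ) :
    ∑ v ∈ W, φ v = 2 * (W.filter fun v => φ v = 2).card := by
  rw [Finset.card_filter]
  push_cast
  rw [Finset.mul_sum]
  refine Finset.sum_congr rfl fun v hv => ?_
  rcases h.2 v hv with h | h <;> simp [h]

lemma rigid_false (hr : Rigid G f W) (hR : Rich G W) {κ : ℝ} (hκ : 0 < κ)
    (hdeg : ∀ v ∈ W, (11 / 16 + κ) * W.card ≤ dg G W v) (hne : W.Nonempty)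
    {T : Finset (Finset V)} (hT : IsKrTilingOn G 3 T W)
    (hlo : ∀ c, (1 / 8 - κ / 4) * W.card ≤ tilingColorCount f T c)
    (hhi : ∀ c, (tilingColorCount f T c : ℝ) ≤ (1 / 8 + κ) * W.card) : False := by
  have hm : (0 : ℝ) < W.card := by exact_mod_cast hne.card_pos
  obtain ⟨p, hp⟩ := hne
  have hκ' : κ ≤ 5 / 16 := by
    have h1 := hdeg p hp
    have h2 : (dg G W p : ℝ) ≤ W.card := by exact_mod_cast Finset.card_filter_le _ _
    by_contra hcon
    push Not at hcon
    nlinarith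
  obtain ⟨q, r, s, hQ⟩ := hR.k4' hp
  have star : ∀ {p q r s : V}, IsQ G W p q r s → ∀ c, f s(p, q) ≠ c → f s(p, r) ≠ c →
      f s(p, s) ≠ c → f s(q, r) ≠ c → f s(q, s) ≠ c → f s(r, s) ≠ c → ∃ φ, IsStar G f W c φ := by
    intro p q r s hQ c h1 h2 h3 h4 h5 h6
    obtain ⟨φ, hφ, e1, e2, e3, e4⟩ := hr.pot hR hQ h1 h2 h3 h4 h5 h6
    refine ⟨φ, hφ, hφ.star hR hκ hdeg hQ e1 e2 e3 e4 ?_⟩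
    have := count_phi f c hT φ hφ
    rw [← this]
    exact_mod_cast hhi c
  obtain ⟨c0, -, hc0⟩ := Finset.exists_mem_notMem_of_card_lt_card (s :=
    ({f s(p, q), f s(p, r), f s(p, s), f s(q, r), f s(q, s), f s(r, s)} : Finset (Fin 8)))
    (t := Finset.univ) (lt_of_le_of_lt Finset.card_le_six (by simp))
  simp only [mem_insert, mem_singleton, not_or] at hc0
  obtain ⟨n1, n2, n3, n4, n5, n6⟩ := hc0
  obtain ⟨φ0, hφ0⟩ := star hQ c0 (Ne.symm n1) (Ne.symm n2) (Ne.symm n3) (Ne.symm n4) (Ne.symm n5)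
    (Ne.symm n6)
  have size : ∀ c φ, IsStar G f W c φ →
      (1 / 16 - κ / 8) * W.card ≤ (W.filter fun v => φ v = 2).card := by
    intro c φ h
    have h1 := count_phi f c hT φ h.1
    rw [h.card] at h1
    have h2 : (tilingColorCount f T c : ℝ) = 2 * (W.filter fun v => φ v = 2).card := by
      exact_mod_cast h1
    have := hlo c
    linarith
  have hpos0 : (0 : ℝ) < (W.filter fun v => φ0 v = 2).card := by
    refine lt_of_lt_of_le ?_ (size c0 φ0 hφ0)
    apply mul_pos _ hm
    linarith
  obtain ⟨a, ha⟩ := Finset.card_pos.1 (by exact_mod_cast hpos0)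
  rw [Finset.mem_filter] at ha
  obtain ⟨haW, ha2⟩ := ha
  obtain ⟨x, y, z, hK⟩ := hR.k4' haW
  obtain ⟨-, hx, hy, hz, a1, a2, a3, a4, a5, a6⟩ := id hK
  have hcol : f s(a, x) = c0 ∧ f s(a, y) = c0 ∧ f s(a, z) = c0 := by
    have e1 := hφ0.1 a haW x hx y hy a1 a2 a4
    have e2 := hφ0.1 a haW x hx z hz a1 a3 a5
    have e3 := hφ0.1 a haW y hy z hz a2 a3 a6
    have e4 := hφ0.1 x hx y hy z hz a4 a5 a6
    have g1 := hφ0.2 x hx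
    have g2 := hφ0.2 y hy
    have g3 := hφ0.2 z hz
    have h1 := hh_cases f c0 a x
    have h2 := hh_cases f c0 a y
    have h3 := hh_cases f c0 a z
    have h4 := hh_cases f c0 x y
    have h5 := hh_cases f c0 x z
    have h6 := hh_cases f c0 y z
    have k1 : hh f c0 a x = 1 := by omega
    have k2 : hh f c0 a y = 1 := by omega
    have k3 : hh f c0 a z = 1 := by omega
    unfold hh at k1 k2 k3
    refine ⟨?_, ?_, ?_⟩
    · by_contra h; simp [h] at k1
    · by_contra h; simp [h] at k2
    · by_contra h; simp [h] at k3
  set B : Finset (Fin 8) := {f s(x, y), f s(x, z), f s(y, z)} with hB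
  have hstar : ∀ c, ∃ φ, c ∉ B → IsStar G f W c φ := by
    intro c
    by_cases hcB : c ∈ B
    · exact ⟨0, fun h => absurd hcB h⟩
    · by_cases hcc : c = c0
      · exact ⟨φ0, fun _ => hcc ▸ hφ0⟩
      · simp only [hB, mem_insert, mem_singleton, not_or] at hcB
        obtain ⟨φ, hφ⟩ := star hK c (by rw [hcol.1]; exact Ne.symm hcc)
          (by rw [hcol.2.1]; exact Ne.symm hcc) (by rw [hcol.2.2]; exact Ne.symm hcc)
          (Ne.symm hcB.1) (Ne.symm hcB.2.1) (Ne.symm hcB.2.2)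
        exact ⟨φ, fun _ => hφ⟩
  choose Φ hΦ using hstar
  have hBc : 5 ≤ (Finset.univ \ B).card := by
    have h1 : B.card ≤ 3 := Finset.card_le_three
    have h2 := Finset.card_sdiff_add_card_eq_card (Finset.subset_univ B)
    simp only [Finset.card_univ, Fintype.card_fin] at h2
    omega
  set I := (Finset.univ \ B).biUnion fun c => W.filter fun v => Φ c v = 2 with hI
  have hIW : I ⊆ W := by
    rw [hI, Finset.biUnion_subset]
    exact fun c _ => Finset.filter_subset _ _
  have nonneg : ∀ c, c ∉ B → ∀ v ∈ W, 0 ≤ Φ c v := by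
    intro c hc v hv
    rcases (hΦ c hc).2 v hv with h | h <;> omega
  have hIc : I.card = ∑ c ∈ Finset.univ \ B, (W.filter fun v => Φ c v = 2).card := by
    rw [hI, Finset.card_biUnion]
    intro c hc d hd hcd
    have hc' := (Finset.mem_sdiff.1 hc).2
    have hd' := (Finset.mem_sdiff.1 hd).2
    rw [Function.onFun, Finset.disjoint_left]
    intro v hv hv'
    rw [Finset.mem_filter] at hv hv'
    obtain ⟨y, z, ⟨b1, b2, b3, b4, b5, b6, b7⟩, -, -⟩ := hR.lk hv.1 hv.1 ∅ (by simp)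
    have := (hΦ c hc').tri (hΦ d hd') hcd hv.1 b1 b2 b3 b4 b7
    have := nonneg c hc' y b1
    have := nonneg c hc' z b2
    have := nonneg d hd' y b1
    have := nonneg d hd' z b2
    omega
  have hind : ∀ v ∈ I, ∀ w ∈ I, ¬ G.Adj v w := by
    intro v hv w hw hvw
    rw [hI, Finset.mem_biUnion] at hv hw
    obtain ⟨c, hc, hv⟩ := hv
    obtain ⟨d, hd, hw⟩ := hw
    have hc' := (Finset.mem_sdiff.1 hc).2
    have hd' := (Finset.mem_sdiff.1 hd).2
    rw [Finset.mem_filter] at hv hw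
    obtain ⟨t, ht, -, t1, t2, -⟩ := hR v hv.1 w hw.1 w hw.1 ∅ (by simp)
    have := nonneg c hc' w hw.1
    have := nonneg c hc' t ht
    have := nonneg d hd' v hv.1
    have := nonneg d hd' t ht
    by_cases hcd : c = d
    · subst hcd
      have e := (hΦ c hc').1 v hv.1 w hw.1 t ht hvw t1 t2
      have h1 := hh_cases f c v w
      have h2 := hh_cases f c v t
      have h3 := hh_cases f c w t
      omega
    · have := (hΦ c hc').tri (hΦ d hd') hcd hv.1 hw.1 ht hvw t1 t2
      omega
  have hIlb : 5 * ((1 / 16 - κ / 8) * W.card) ≤ (I.card : ℝ) := by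
    rw [hIc]
    push_cast
    calc 5 * ((1 / 16 - κ / 8) * W.card) ≤ (Finset.univ \ B).card * ((1 / 16 - κ / 8) * W.card) := by
          have h5 : (5 : ℝ) ≤ (Finset.univ \ B).card := by exact_mod_cast hBc
          apply mul_le_mul_of_nonneg_right h5
          apply mul_nonneg _ hm.le
          linarith
      _ = ∑ c ∈ Finset.univ \ B, (1 / 16 - κ / 8) * (W.card : ℝ) := by simp
      _ ≤ _ := Finset.sum_le_sum fun c hc => size c _ (hΦ c (Finset.mem_sdiff.1 hc).2)
  have hIpos : (0 : ℝ) < I.card := by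
    refine lt_of_lt_of_le ?_ hIlb
    apply mul_pos (by norm_num)
    apply mul_pos _ hm
    linarith
  obtain ⟨v, hv⟩ := Finset.card_pos.1 (by exact_mod_cast hIpos)
  have h1 := indep_le (G := G) hIW (hind v hv)
  have h1' : (dg G W v : ℝ) + I.card ≤ W.card := by exact_mod_cast h1
  have h2 := hdeg v (hIW hv)
  have : 0 < κ * W.card := by positivity
  linarith
end finish

section gadget
variable [Fintype V] [DecidableEq V] {G : SimpleGraph V} {f : Sym2 V → Fin 8}

/-- A collection of gadgets on `R` with gains `k`. -/
def Gad (G : SimpleGraph V) (f : Sym2 V → Fin 8) (R : Finset V) (N : ℕ) : Prop :=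
  ∃ (B : Finset (Finset V)) (τ : Fin 8 → Finset (Finset V)) (k : Fin 8 → ℕ),
    IsKrTilingOn G 3 B R ∧ (∀ c, IsKrTilingOn G 3 (τ c) R) ∧
    (∀ c, tilingColorCount f B c + k c ≤ tilingColorCount f (τ c) c) ∧
    ∑ c, k c = N ∧ R.card ≤ 12 * N

lemma Gad.step {R U : Finset V} {N : ℕ} (h : Gad G f R N) (hd : Disjoint R U) (hU : U.card ≤ 12)
    {T1 T2 : Finset (Finset V)} (h1 : IsKrTilingOn G 3 T1 U) (h2 : IsKrTilingOn G 3 T2 U) {c : Fin 8}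
    (hc : tilingColorCount f T2 c < tilingColorCount f T1 c) : Gad G f (R ∪ U) (N + 1) := by
  obtain ⟨B, τ, k, hB, hτ, hk, hs, hR⟩ := h
  refine ⟨B ∪ T2, fun d => if d = c then τ d ∪ T1 else τ d ∪ T2, fun d => k d + if d = c then 1 else 0,
    hB.union h2 hd, ?_, ?_, ?_, ?_⟩
  · intro d
    dsimp only
    split_ifs
    · exact (hτ d).union h1 hd
    · exact (hτ d).union h2 hd
  · intro d
    dsimp only
    have := hk d
    rw [count_union f d hB h2 hd]
    split_ifs with hdc
    · subst hdc
      rw [count_union f d (hτ d) h1 hd]; omega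
    · rw [count_union f d (hτ d) h2 hd]; omega
  · rw [Finset.sum_add_distrib, hs]; simp
  · have := Finset.card_union_le R U
    omega

lemma gad_exists (G : SimpleGraph V) (f : Sym2 V → Fin 8) (N : ℕ) :
    ∃ R N', Gad G f R N' ∧ (N' = N ∨ (N' ≤ N ∧ Rigid G f (Finset.univ \ R))) := by
  induction N with
  | zero =>
    refine ⟨∅, 0, ⟨∅, fun _ => ∅, fun _ => 0, IsKrTilingOn.empty, fun _ => IsKrTilingOn.empty,
      by simp, by simp, by simp⟩, Or.inl rfl⟩
  | succ N ih =>
    obtain ⟨R, N', hG, h | ⟨h, h'⟩⟩ := ih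
    · subst h
      by_cases hr : Rigid G f (Finset.univ \ R)
      · exact ⟨R, N', hG, Or.inr ⟨by omega, hr⟩⟩
      · unfold Rigid at hr
        push Not at hr
        obtain ⟨U, hU, hc, T1, T2, h1, h2, c, hne⟩ := hr
        have hd : Disjoint R U := Finset.disjoint_sdiff.mono_right hU
        rcases lt_or_gt_of_ne hne with hlt | hlt
        · exact ⟨R ∪ U, N' + 1, hG.step hd hc h2 h1 hlt, Or.inl rfl⟩
        · exact ⟨R ∪ U, N' + 1, hG.step hd hc h1 h2 hlt, Or.inl rfl⟩
    · exact ⟨R, N', hG, Or.inr ⟨by omega, h'⟩⟩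
end gadget

section final

lemma dg_univ {n : ℕ} (G : SimpleGraph (Fin n)) [DecidableRel G.Adj] (v : Fin n) :
    dg G Finset.univ v = G.degree v := by
  unfold dg
  rw [← SimpleGraph.card_neighborFinset_eq_degree, SimpleGraph.neighborFinset_eq_filter]

lemma count_lower {n : ℕ} {G : SimpleGraph (Fin n)} {f : Sym2 (Fin n) → Fin 8} {ζ : ℝ}
    (hneg : ∀ T, IsKrTiling G 3 T → ∀ c, (tilingColorCount f T c : ℝ) ≤ (n + ζ * n) / 8)
    {T : Finset (Finset (Fin n))} (hT : IsKrTiling G 3 T) (c : Fin 8) :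
    (n : ℝ) / 8 - 7 * ζ * n / 8 ≤ tilingColorCount f T c := by
  have h1 := count_sum f hT
  rw [Finset.card_univ, Fintype.card_fin, ← Finset.add_sum_erase _ _ (Finset.mem_univ c)] at h1
  have h2 : (tilingColorCount f T c : ℝ) + ∑ d ∈ Finset.univ.erase c, (tilingColorCount f T d : ℝ) = n := by
    exact_mod_cast h1
  have h3 := Finset.sum_le_sum (s := Finset.univ.erase c) fun d _ => hneg T hT d
  rw [Finset.sum_const, Finset.card_erase_of_mem (Finset.mem_univ c), Finset.card_univ,
    Fintype.card_fin, nsmul_eq_mul] at h3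
  have h7 : ((8 - 1 : ℕ) : ℝ) = 7 := by norm_num
  rw [h7] at h3
  linarith

end final

/-- **Theorem.** `δ_{3,8} ≤ 11/16`. -/
theorem delta_3_8_le (ε : ℝ) (hε : 0 < ε) :
    ∃ ζ : ℝ, 0 < ζ ∧ ∃ n₀ : ℕ, ∀ n : ℕ, n₀ ≤ n → 3 ∣ n →
      ∀ (G : SimpleGraph (Fin n)) [DecidableRel G.Adj],
        ((11 : ℝ) / 16 + ε) * n ≤ G.minDegree →
        ∀ f : Sym2 (Fin n) → Fin 8,
          ∃ T : Finset (Finset (Fin n)), IsKrTiling G 3 T ∧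
            ∃ c : Fin 8,
              ((tilingEdgeCount T : ℝ) + ζ * n) / 8 ≤ (tilingColorCount f T c : ℝ) := by
  obtain ⟨t0, ht0⟩ := tile_exists
  obtain ⟨β, hβ⟩ : ∃ β, β = ε / 32 := ⟨_, rfl⟩
  have hβ0 : 0 < β := by rw [hβ]; positivity
  refine ⟨β / 200, by positivity, 2 * t0 + 2000 + ⌈200 / β⌉₊, ?_⟩
  intro n hn h3 G _ hdeg f
  by_contra hcon
  push Not at hcon
  have hneg : ∀ T, IsKrTiling G 3 T → ∀ c,
      (tilingColorCount f T c : ℝ) ≤ (n + β / 200 * n) / 8 := by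
    intro T hT c
    have h1 := hcon T hT c
    rw [edge_count hT, Finset.card_univ, Fintype.card_fin] at h1
    exact h1.le
  have hnpos : 0 < n := by omega
  have hnR : (0 : ℝ) < n := by exact_mod_cast hnpos
  have hdv : ∀ v, (11 / 16 + ε) * n ≤ (dg G Finset.univ v : ℝ) := by
    intro v
    rw [dg_univ]
    refine hdeg.trans ?_
    exact_mod_cast G.minDegree_le_degree v
  have hε1 : ε < 5 / 16 := by
    have h1 := hdv ⟨0, hnpos⟩
    have h2 : (dg G Finset.univ (⟨0, hnpos⟩ : Fin n) : ℝ) < n := by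
      rw [dg_univ]
      have := G.degree_lt_card_verts ⟨0, hnpos⟩
      rw [Fintype.card_fin] at this
      exact_mod_cast this
    by_contra hc
    push Not at hc
    nlinarith
  have hβn : 200 ≤ β * n := by
    have h1 : 200 / β ≤ n := by
      refine (Nat.le_ceil _).trans ?_
      exact_mod_cast (by omega : ⌈200 / β⌉₊ ≤ n)
    rw [div_le_iff₀ hβ0] at h1
    linarith
  obtain ⟨m, hm⟩ : ∃ m, m = ⌊β * n / 96⌋₊ := ⟨_, rfl⟩
  have hm1 : (m : ℝ) ≤ β * n / 96 := by rw [hm]; exact Nat.floor_le (by positivity)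
  have hm2 : β * n / 96 < m + 1 := by rw [hm]; exact Nat.lt_floor_add_one _
  obtain ⟨R, N', ⟨B, τ, k, hB, hτ, hk, hs, hRc⟩, hor⟩ := gad_exists G f (8 * m)
  have hN' : N' ≤ 8 * m := by rcases hor with h | h <;> omega
  have hR : (R.card : ℝ) ≤ β * n := by
    have : R.card ≤ 96 * m := by omega
    have : (R.card : ℝ) ≤ 96 * m := by exact_mod_cast this
    linarith
  set W := Finset.univ \ R with hW
  have hWR := Finset.card_sdiff_add_card_eq_card (Finset.subset_univ R)
  rw [← hW, Finset.card_univ, Fintype.card_fin] at hWR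
  have hWR' : (W.card : ℝ) + R.card = n := by exact_mod_cast hWR
  have hWn : (W.card : ℝ) ≤ n := by
    have : (0 : ℝ) ≤ R.card := by positivity
    linarith
  have hWdeg : ∀ v ∈ W, (11 / 16 + ε / 2) * W.card ≤ (dg G W v : ℝ) := by
    intro v _
    have h1 := hdv v
    have h2 : (dg G Finset.univ v : ℝ) ≤ dg G W v + R.card := by
      exact_mod_cast dg_sdiff_le (G := G) Finset.univ R v
    have h3 : (11 / 16 + ε / 2) * W.card ≤ (11 / 16 + ε / 2) * n := by gcongr
    have h4 : β * n ≤ ε / 2 * n := by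
      apply mul_le_mul_of_nonneg_right _ hnR.le
      rw [hβ]; linarith
    linarith
  have hWdeg' : ∀ v ∈ W, 11 * W.card ≤ 16 * dg G W v := by
    intro v hv
    have h1 := hWdeg v hv
    have h2 : (0 : ℝ) ≤ ε / 2 * W.card := by positivity
    have h3 : (11 : ℝ) * W.card ≤ 16 * dg G W v := by linarith
    exact_mod_cast h3
  have hWhalf : n ≤ 2 * W.card := by
    have h1 : β * n ≤ 1 / 2 * n := by
      apply mul_le_mul_of_nonneg_right _ hnR.le
      rw [hβ]; linarith
    have : (n : ℝ) ≤ 2 * W.card := by linarith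
    exact_mod_cast this
  have hWhalf' : (n : ℝ) ≤ 2 * W.card := by exact_mod_cast hWhalf
  have hB3 := hB.card_eq
  obtain ⟨T, hT⟩ := ht0 G W (by omega) (by omega) hWdeg'
  have hdis : Disjoint W R := Finset.sdiff_disjoint
  have hWRu : W ∪ R = Finset.univ := Finset.sdiff_union_of_subset (Finset.subset_univ R)
  have tB : IsKrTiling G 3 (T ∪ B) := by
    have := hT.union hB hdis
    rwa [hWRu] at this
  have tτ : ∀ c, IsKrTiling G 3 (T ∪ τ c) := by
    intro c
    have := hT.union (hτ c) hdis
    rwa [hWRu] at this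
  rcases hor with h | ⟨-, hrig⟩
  · -- many gadgets
    have hex : ∃ c, m ≤ k c := by
      by_contra hno
      push Not at hno
      have h1 := Finset.sum_lt_sum_of_nonempty (s := (Finset.univ : Finset (Fin 8))) ⟨0, by simp⟩
        (fun c _ => hno c)
      rw [Finset.sum_const, Finset.card_univ, Fintype.card_fin, smul_eq_mul] at h1
      omega
    obtain ⟨c, hc⟩ := hex
    have h1 := count_lower hneg tB c
    have h2 := hneg _ (tτ c) c
    have h3 := hk c
    have h4 : tilingColorCount f (T ∪ B) c + m ≤ tilingColorCount f (T ∪ τ c) c := by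
      rw [count_union f c hT hB hdis, count_union f c hT (hτ c) hdis]
      omega
    have h5 : (tilingColorCount f (T ∪ B) c : ℝ) + m ≤ tilingColorCount f (T ∪ τ c) c := by
      exact_mod_cast h4
    linarith
  · have hrich : Rich G W := rich_of_deg hWdeg' (by omega)
    refine rigid_false hrig hrich (κ := ε / 2) (by positivity) hWdeg
      (Finset.card_pos.1 (by omega)) hT ?_ ?_
    · intro c
      have h1 := count_lower hneg tB c
      have h2 : tilingColorCount f B c ≤ R.card := by
        rw [← count_sum f hB]
        exact Finset.single_le_sum (f := fun c => tilingColorCount f B c) (fun _ _ => Nat.zero_le _)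
          (Finset.mem_univ c)
      rw [count_union f c hT hB hdis] at h1
      push_cast at h1
      have h2' : (tilingColorCount f B c : ℝ) ≤ R.card := by exact_mod_cast h2
      have h6 : 4 * β * n ≤ 4 * β * (2 * W.card) := by gcongr
      have h7 : ε / 2 / 4 * W.card = 4 * β * W.card := by rw [hβ]; ring
      nlinarith
    · intro c
      have h1 := hneg _ tB c
      rw [count_union f c hT hB hdis] at h1
      push_cast at h1
      have h2 : (0 : ℝ) ≤ tilingColorCount f B c := by positivity
      have h6 : 4 * β * n ≤ 4 * β * (2 * W.card) := by gcongr
      have h7 : ε / 2 * W.card = 16 * β * W.card := by rw [hβ]; ring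
      nlinarith
end

section
/- Let r, q be integers with r ≥ 3 and C(r,2) ≤ q ≤ C(r+1,2). For every N ∈ ℕ there exists an integer n > N divisible by r, an n-vertex graph G with minimum degree δ(G) = (r/(r+1))·n, and a q-edge-coloring f : E(G) → {1,…,q}, such that every K_r-tiling of G has discrepancy 0 with respect to f; that is, in every K_r-tiling of G every color appears on exactly e(T)/q of the edges of the tiling T. -/
open Finset

variable {V : Type*}

attribute [local instance] Classical.propDecidable

/-- The number of edges of `K` of color `c` avoiding the part `0`. -/
noncomputable def auxB {V : Type*} [DecidableEq V] {r q : ℕ} (p : V → Fin (r+1))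
    (f : Sym2 V → Fin q) (c : Fin q) (K : Finset V) : ℕ :=
  (K.sym2.filter fun e => (¬ e.IsDiag ∧ f e = c) ∧ ¬ ∃ v ∈ e, p v = 0).card

lemma aux_split {V : Type*} [DecidableEq V] {r q : ℕ} (p : V → Fin (r+1))
    (f : Sym2 V → Fin q) (c : Fin q) (K : Finset V) :
    (K.sym2.filter fun e => ¬ e.IsDiag ∧ f e = c).card =
    (K.sym2.filter fun e => (¬ e.IsDiag ∧ f e = c) ∧ ∃ v ∈ e, p v = 0).card + auxB p f c K := by
  unfold auxB
  rw [← Finset.filter_filter _ (fun e => ∃ v ∈ e, p v = 0),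
      ← Finset.filter_filter _ (fun e => ¬ ∃ v ∈ e, p v = 0),
      Finset.card_filter_add_card_filter_not]

lemma aux_card_nondiag {V : Type*} [DecidableEq V] (K : Finset V) :
    (K.sym2.filter fun e => ¬ e.IsDiag).card = K.card.choose 2 := by
  rw [← Sym2.card_image_offDiag]
  congr 1
  ext e
  induction e with | h x y => 
  simp only [Finset.mem_filter, Finset.mk_mem_sym2_iff, Sym2.mk_isDiag_iff, Finset.mem_image, Finset.mem_offDiag, Prod.exists]
  constructor
  · rintro ⟨⟨h1, h2⟩, h3⟩
    exact ⟨x, y, ⟨h1, h2, h3⟩, rfl⟩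
  · rintro ⟨a, b, ⟨h1, h2, h3⟩, h4⟩
    rcases Sym2.eq_iff.1 h4 with ⟨rfl, rfl⟩ | ⟨rfl, rfl⟩
    · exact ⟨⟨h1, h2⟩, h3⟩
    · exact ⟨⟨h2, h1⟩, fun h => h3 h.symm⟩

lemma aux_A {V : Type*} [DecidableEq V] {r q : ℕ} (p : V → Fin (r+1)) (γ : V → Fin q)
    (f : Sym2 V → Fin q)
    (hf0 : ∀ u v, p u = 0 → p v ≠ 0 → f s(u,v) = γ u)
    (K : Finset V) (hK : K.card = r) (hp : Set.InjOn p K) (c : Fin q) :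
    (K.sym2.filter fun e => (¬ e.IsDiag ∧ f e = c) ∧ ∃ v ∈ e, p v = 0).card
      = (r-1) * (K.filter fun v => p v = 0 ∧ γ v = c).card := by
  by_cases hz : ∃ v ∈ K, p v = 0 ∧ γ v = c
  · obtain ⟨v, hv, hv0, hvc⟩ := hz
    have h1 : (K.filter fun v => p v = 0 ∧ γ v = c) = {v} := by
      ext w
      simp only [Finset.mem_filter, Finset.mem_singleton]
      constructor
      · rintro ⟨h1, h2, h3⟩
        exact hp h1 hv (h2.trans hv0.symm)
      · rintro rfl; exact ⟨hv, hv0, hvc⟩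
    have h2 : (K.sym2.filter fun e => (¬ e.IsDiag ∧ f e = c) ∧ ∃ v ∈ e, p v = 0)
        = (K.erase v).image (fun u => s(v, u)) := by
      ext e
      simp only [Finset.mem_filter, Finset.mem_image, Finset.mem_erase]
      constructor
      · rintro ⟨he, ⟨hd, hc⟩, w, hw, hw0⟩
        obtain ⟨u, rfl⟩ := Sym2.mem_iff_exists.1 hw
        rw [Finset.mk_mem_sym2_iff] at he
        have := hp he.1 hv (hw0.trans hv0.symm)
        subst this
        exact ⟨u, ⟨fun h => hd (by simp [h]), he.2⟩, rfl⟩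
      · rintro ⟨u, ⟨hne, hu⟩, rfl⟩
        have : p u ≠ 0 := fun h => hne (hp hu hv (h.trans hv0.symm))
        refine ⟨by simp [hv, hu], ⟨by simpa using fun h => hne h.symm, ?_⟩, v, by simp, hv0⟩
        rw [hf0 v u hv0 this, hvc]
    rw [h1, h2, Finset.card_image_of_injective, Finset.card_erase_of_mem hv, hK]
    · simp
    · intro a b h
      exact Sym2.congr_right.1 h
  · have h1 : (K.filter fun v => p v = 0 ∧ γ v = c) = ∅ := by
      rw [Finset.filter_eq_empty_iff]
      exact fun v hv h => hz ⟨v, hv, h⟩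
    rw [h1, Finset.card_empty, mul_zero, Finset.card_eq_zero, Finset.filter_eq_empty_iff]
    rintro e he ⟨⟨hd, hc⟩, w, hw, hw0⟩
    obtain ⟨u, rfl⟩ := Sym2.mem_iff_exists.1 hw
    rw [Finset.mk_mem_sym2_iff] at he
    have hne : p u ≠ 0 := fun h => hd (by simpa using hp he.1 he.2 (hw0.trans h.symm))
    exact hz ⟨w, he.1, hw0, by rw [← hf0 w u hw0 hne, hc]⟩

lemma aux_hit {V : Type*} [DecidableEq V] {r : ℕ} (p : V → Fin (r+1))
    (K : Finset V) (hp : Set.InjOn p K) (i : Fin (r+1)) :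
    (K.filter fun v => p v = i).card = if i ∈ K.image p then 1 else 0 := by
  split_ifs with h
  · obtain ⟨v, hv, rfl⟩ := Finset.mem_image.1 h
    rw [Finset.card_eq_one]
    refine ⟨v, ?_⟩
    ext w
    simp only [Finset.mem_filter, Finset.mem_singleton]
    exact ⟨fun h => hp h.1 hv h.2, by rintro rfl; exact ⟨hv, rfl⟩⟩
  · rw [Finset.card_eq_zero, Finset.filter_eq_empty_iff]
    exact fun v hv hvi => h (Finset.mem_image.2 ⟨v, hv, hvi⟩)

lemma aux_B1 {V : Type*} [DecidableEq V] {r q : ℕ} (p : V → Fin (r+1))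
    (f : Sym2 V → Fin q) (h : Sym2 (Fin (r+1)) → Fin q)
    (hinj : Set.InjOn h {e | ¬ e.IsDiag ∧ (0 : Fin (r+1)) ∉ e})
    (hf1 : ∀ u v, p u ≠ 0 → p v ≠ 0 → f s(u,v) = h s(p u, p v))
    (K : Finset V) (hK : K.card = r) (hp : Set.InjOn p K) (c : Fin q)
    (i j : Fin (r+1)) (hi : i ≠ 0) (hj : j ≠ 0) (hij : i ≠ j) (hc : h s(i,j) = c) :
    auxB p f c K + 1
      = (K.filter fun v => p v = i).card + (K.filter fun v => p v = j).card := by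
  have himg : (K.image p)ᶜ.card = 1 := by
    rw [Finset.card_compl, Finset.card_image_of_injOn hp, hK]; simp
  rw [aux_hit p K hp, aux_hit p K hp]
  unfold auxB
  have key : ∀ e ∈ K.sym2, (¬ e.IsDiag ∧ f e = c) → (¬ ∃ v ∈ e, p v = 0) → e.map p = s(i,j) := by
    intro e
    induction e with | h x y =>
    intro he ⟨hd, hfc⟩ hz
    rw [Finset.mk_mem_sym2_iff] at he
    have hx : p x ≠ 0 := fun h => hz ⟨x, by simp, h⟩
    have hy : p y ≠ 0 := fun h => hz ⟨y, by simp, h⟩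
    rw [hf1 x y hx hy, ← hc] at hfc
    refine hinj ⟨?_, ?_⟩ ⟨?_, ?_⟩ hfc
    · simp only [Sym2.mk_isDiag_iff] at hd ⊢
      exact fun h => hd (hp he.1 he.2 h)
    · simp [hx.symm, hy.symm]
    · simpa using hij
    · simp [hi.symm, hj.symm]
  by_cases h1 : i ∈ K.image p <;> by_cases h2 : j ∈ K.image p
  · obtain ⟨u, hu, hui⟩ := Finset.mem_image.1 h1
    obtain ⟨v, hv, hvj⟩ := Finset.mem_image.1 h2
    have : (K.sym2.filter fun e => (¬ e.IsDiag ∧ f e = c) ∧ ¬ ∃ v ∈ e, p v = 0) = {s(u,v)} := by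
      ext e
      simp only [Finset.mem_filter, Finset.mem_singleton]
      constructor
      · rintro ⟨he, h3, h4⟩
        have := key e he h3 h4
        revert he this
        induction e with | h x y =>
        intro he this
        rw [Finset.mk_mem_sym2_iff] at he
        rw [Sym2.map_mk, Sym2.eq_iff] at this
        rcases this with ⟨ha, hb⟩ | ⟨ha, hb⟩
        · rw [hp he.1 hu (ha.trans hui.symm), hp he.2 hv (hb.trans hvj.symm)]
        · rw [hp he.1 hv (ha.trans hvj.symm), hp he.2 hu (hb.trans hui.symm), Sym2.eq_swap]
      · rintro rfl
        refine ⟨by simp [hu, hv], ⟨?_, ?_⟩, ?_⟩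
        · simp only [Sym2.mk_isDiag_iff]
          rintro rfl
          exact hij (hui.symm.trans hvj)
        · rw [hf1 _ _ (hui ▸ hi) (hvj ▸ hj), hui, hvj, hc]
        · simp [hui, hvj, hi, hj]
    rw [this]; simp [h1, h2]
  all_goals
    have h0 : (K.sym2.filter fun e => (¬ e.IsDiag ∧ f e = c) ∧ ¬ ∃ v ∈ e, p v = 0) = ∅ := by
      rw [Finset.filter_eq_empty_iff]
      rintro e he ⟨h3, h4⟩
      have := key e he h3 h4
      revert he this
      induction e with | h x y =>
      intro he this
      rw [Finset.mk_mem_sym2_iff] at he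
      have hx := Finset.mem_image_of_mem p he.1
      have hy := Finset.mem_image_of_mem p he.2
      rw [Sym2.map_mk, Sym2.eq_iff] at this
      rcases this with ⟨ha, hb⟩ | ⟨ha, hb⟩ <;> rw [ha] at hx <;> rw [hb] at hy <;> tauto
    rw [h0]
  · simp [h1, h2]
  · simp [h1, h2]
  · exact absurd (Finset.card_le_one.1 himg.le i (by simpa using h1) j (by simpa using h2)) hij

lemma aux_B2 {V : Type*} [DecidableEq V] {r q : ℕ} (p : V → Fin (r+1))
    (f : Sym2 V → Fin q) (h : Sym2 (Fin (r+1)) → Fin q)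
    (hf1 : ∀ u v, p u ≠ 0 → p v ≠ 0 → f s(u,v) = h s(p u, p v))
    (K : Finset V) (hp : Set.InjOn p K) (c : Fin q)
    (hc : ∀ i j, i ≠ 0 → j ≠ 0 → i ≠ j → h s(i,j) ≠ c) :
    auxB p f c K = 0 := by
  unfold auxB
  rw [Finset.card_eq_zero, Finset.filter_eq_empty_iff]
  intro e
  induction e with | h x y =>
  rintro he ⟨⟨hd, hfc⟩, hz⟩
  rw [Finset.mk_mem_sym2_iff] at he
  have hx : p x ≠ 0 := fun h => hz ⟨x, by simp, h⟩
  have hy : p y ≠ 0 := fun h => hz ⟨y, by simp, h⟩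
  refine hc _ _ hx hy (fun h => hd ?_) ((hf1 x y hx hy).symm.trans hfc)
  simpa using hp he.1 he.2 h

lemma aux_h (r q : ℕ) (hq : r * (r - 1) / 2 ≤ q) (hq0 : 0 < q) :
    ∃ h : Sym2 (Fin (r+1)) → Fin q,
      Set.InjOn h {e | ¬ e.IsDiag ∧ (0 : Fin (r+1)) ∉ e} ∧
      ((((Finset.univ.erase (0 : Fin (r+1))).sym2.filter fun e => ¬ e.IsDiag).image h).card
        = r * (r-1) / 2) := by
  set D := ((Finset.univ.erase (0 : Fin (r+1))).sym2.filter fun e => ¬ e.IsDiag) with hD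
  have hDc : D.card = r * (r-1) / 2 := by
    rw [hD, aux_card_nondiag, Nat.choose_two_right]; simp
  obtain ⟨φ⟩ : Nonempty (D ↪ Fin q) :=
    Function.Embedding.nonempty_of_card_le (by simpa [hDc] using hq)
  obtain ⟨h, hi⟩ : ∃ h : Sym2 (Fin (r+1)) → Fin q, Set.InjOn h D := by
    refine ⟨fun e => if he : e ∈ D then φ ⟨e, he⟩ else ⟨0, hq0⟩, ?_⟩
    intro a ha b hb hab
    have ha' : a ∈ D := ha
    have hb' : b ∈ D := hb
    simp only [ha', hb', dif_pos] at hab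
    simpa using φ.injective hab
  refine ⟨h, hi.mono ?_, by rw [Finset.card_image_of_injOn hi, hDc]⟩
  intro e
  induction e with | h x y =>
  rintro ⟨h1, h2⟩
  simp only [Sym2.mem_iff, not_or] at h2
  rw [hD, Finset.mem_coe, Finset.mem_filter, Finset.mk_mem_sym2_iff]
  exact ⟨⟨Finset.mem_erase.2 ⟨fun h => h2.1 h.symm, Finset.mem_univ _⟩,
    Finset.mem_erase.2 ⟨fun h => h2.2 h.symm, Finset.mem_univ _⟩⟩, h1⟩

lemma aux_g {q : ℕ} (s : ℕ) (w : Fin q → ℕ) (hw : ∑ c, w c = s) :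
    ∃ g : Fin s → Fin q, ∀ c, (Finset.univ.filter fun x => g x = c).card = w c := by
  have e : Fin s ≃ Σ c, Fin (w c) := Fintype.equivOfCardEq (by simp [hw])
  refine ⟨fun x => (e x).1, fun c => ?_⟩
  have : (Finset.univ.filter fun x => (e x).1 = c).card
      = (Finset.univ.filter fun y : Σ c, Fin (w c) => y.1 = c).card := by
    apply Finset.card_bij (fun x _ => e x) <;> simp
    · intro b hb; exact ⟨e.symm b, by simpa using hb, by simp⟩
  rw [this]
  have : (Finset.univ.filter fun y : Σ c, Fin (w c) => y.1 = c)
      = (Finset.univ : Finset (Fin (w c))).map (Function.Embedding.sigmaMk c) := by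
    ext ⟨a, b⟩
    simp only [Finset.mem_filter, Finset.mem_univ, true_and, Finset.mem_map, Function.Embedding.sigmaMk_apply]
    constructor
    · rintro rfl; exact ⟨b, rfl⟩
    · rintro ⟨x, hx⟩; cases hx; rfl
  rw [this]; simp

lemma aux_sum {V : Type*} [Fintype V] [DecidableEq V] (T : Finset (Finset V))
    (hd : ∀ K ∈ T, ∀ K' ∈ T, K ≠ K' → Disjoint K K') (hu : T.biUnion id = Finset.univ)
    (P : V → Prop) [DecidablePred P] :
    ∑ K ∈ T, (K.filter P).card = (Finset.univ.filter P).card := by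
  rw [← hu, Finset.filter_biUnion, Finset.card_biUnion]
  · rfl
  · intro K hK K' hK' hne
    exact Finset.disjoint_filter_filter (hd K hK K' hK' hne)

/-- **Lemma.** For `r ≥ 3` and `C(r,2) ≤ q ≤ C(r+1,2)`: for every `N` there are `n > N` with
`r ∣ n`, an `n`-vertex graph `G` with `δ(G) = (r/(r+1))n` and a `q`-edge-coloring such that
every `K_r`-tiling of `G` has discrepancy `0` (each color appears on exactly `e(T)/q` edges). -/
theorem lower_bound_construction_middle_range (r q : ℕ) (hr : 3 ≤ r)
    (hq1 : r * (r - 1) / 2 ≤ q) (hq2 : q ≤ (r + 1) * r / 2) (N : ℕ) :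
    ∃ n : ℕ, N < n ∧ r ∣ n ∧
      ∃ G : SimpleGraph (Fin n),
        (G.minDegree : ℚ) = (r : ℚ) / (r + 1) * n ∧
        ∃ f : Sym2 (Fin n) → Fin q,
          ∀ T : Finset (Finset (Fin n)), IsKrTiling G r T →
            ∀ c : Fin q, q * tilingColorCount f T c = tilingEdgeCount T := by
  have hr2 : 2 * (r * (r - 1) / 2) = r * (r - 1) :=
    Nat.mul_div_cancel' (Nat.even_mul_pred_self r).two_dvd
  have hr3 : 2 * ((r + 1) * r / 2) = (r + 1) * r :=
    Nat.mul_div_cancel' (by simpa using (Nat.even_mul_pred_self (r+1)).two_dvd)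
  have hq0 : 0 < q := by
    have : 3 * 2 ≤ r * (r - 1) := Nat.mul_le_mul hr (by omega)
    omega
  obtain ⟨h, hinj, hcard⟩ := aux_h r q hq1 hq0
  set b := r * (r - 1) / 2 with hb
  set D := ((Finset.univ.erase (0 : Fin (r+1))).sym2.filter fun e => ¬ e.IsDiag) with hD
  set I := D.image h with hI
  obtain ⟨t, rfl⟩ : ∃ t, r = t + 1 := ⟨r - 1, by omega⟩
  obtain ⟨d, hd⟩ : ∃ d, (t + 1 + 1) * (t + 1) = 2 * q + d := ⟨(t+1+1)*(t+1) - 2*q, by omega⟩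
  obtain ⟨k, hk⟩ : ∃ k, q = b + k := ⟨q - b, by omega⟩
  have hbt : 2 * b = (t + 1) * t := hr2
  obtain ⟨m, hm⟩ : ∃ m, m = N + 1 := ⟨_, rfl⟩
  obtain ⟨w, hw⟩ : ∃ w : Fin q → ℕ, w = fun c => if c ∈ I then d * m else (2 * q + d) * m :=
    ⟨_, rfl⟩
  obtain ⟨s, hs⟩ : ∃ s, s = 2 * q * (t + 1) * m := ⟨_, rfl⟩
  have hws : ∑ c, w c = s := by
    rw [hw, Finset.sum_ite]
    have h1 : (Finset.univ.filter fun c => c ∈ I).card = b := by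
      rw [← hcard]; congr 1; ext; simp
    have h2 : (Finset.univ.filter fun c => c ∉ I).card = k := by
      have := Finset.card_filter_add_card_filter_not (s := (Finset.univ : Finset (Fin q))) (fun c => c ∈ I)
      rw [h1] at this
      simp only [Finset.card_univ, Fintype.card_fin] at this
      omega
    simp only [Finset.sum_const, smul_eq_mul, h1, h2, hs]
    have e1 : b * (d * m) + k * ((2 * q + d) * m) + 2 * b * (q * m) = q * (2 * q + d) * m := by
      rw [hk]; ring
    have e2 : 2 * q * (t + 1) * m + 2 * b * (q * m) = q * (2 * q + d) * m := by
      rw [hbt, ← hd]; ring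
    omega
  obtain ⟨g, hg⟩ := aux_g s w hws
  refine ⟨(t + 1 + 1) * s, ?_, ?_, ?_⟩
  · have : 1 * 1 * 1 * (N+1) ≤ 2 * q * (t + 1) * m := by rw [hm]; gcongr <;> omega
    nlinarith
  · exact ⟨(t+1+1) * (2 * q * m), by rw [hs]; ring⟩
  obtain ⟨E⟩ : Nonempty (Fin (t + 1 + 1) × Fin s ≃ Fin ((t + 1 + 1) * s)) :=
    ⟨finProdFinEquiv⟩
  let p : Fin ((t + 1 + 1) * s) → Fin (t + 1 + 1) := fun v => (E.symm v).1
  let a : Fin ((t + 1 + 1) * s) → Fin s := fun v => (E.symm v).2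
  have hpc : ∀ i, (Finset.univ.filter fun v => p v = i).card = s := by
    intro i
    have : (Finset.univ.filter fun v => p v = i)
        = (Finset.univ : Finset (Fin s)).image (fun x => E (i, x)) := by
      ext v
      simp only [Finset.mem_filter, Finset.mem_univ, true_and, Finset.mem_image]
      constructor
      · rintro rfl; exact ⟨a v, by simp [p, a]⟩
      · rintro ⟨x, rfl⟩; simp [p]
    rw [this, Finset.card_image_of_injective]
    · simp
    · intro x y hxy; simpa using hxy
  have hac : ∀ c, (Finset.univ.filter fun v => p v = 0 ∧ g (a v) = c).card = w c := by
    intro c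
    have : (Finset.univ.filter fun v => p v = 0 ∧ g (a v) = c)
        = (Finset.univ.filter fun x => g x = c).image (fun x => E (0, x)) := by
      ext v
      simp only [Finset.mem_filter, Finset.mem_univ, true_and, Finset.mem_image]
      constructor
      · rintro ⟨h1, h2⟩; exact ⟨a v, h2, by rw [← h1]; simp [p, a]⟩
      · rintro ⟨x, hx, rfl⟩; simp [p, a, hx]
    rw [this, Finset.card_image_of_injective, hg]
    · intro x y hxy; simpa using hxy
  clear_value p a
  obtain ⟨G, hadj⟩ : ∃ G : SimpleGraph (Fin ((t + 1 + 1) * s)),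
      ∀ u v, G.Adj u v ↔ p u ≠ p v :=
    ⟨{ Adj := fun u v => p u ≠ p v
       symm := ⟨fun _ _ h => h.symm⟩
       loopless := ⟨fun _ h => h rfl⟩ }, fun _ _ => Iff.rfl⟩
  have hreg : ∀ v, G.degree v = (t + 1) * s := by
    intro v
    have h1 := Finset.card_filter_add_card_filter_not
      (s := (Finset.univ : Finset (Fin ((t + 1 + 1) * s)))) (fun u => p u = p v)
    rw [hpc] at h1
    have h2 : G.neighborFinset v = Finset.univ.filter fun u => ¬ p u = p v := by
      ext u
      simp [hadj, eq_comm]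
    rw [← SimpleGraph.card_neighborFinset_eq_degree, h2]
    simp only [Finset.card_univ, Fintype.card_fin] at h1
    linarith
  have hs0 : 0 < s := by
    rw [hs, hm]; positivity
  refine ⟨G, ?_, ?_⟩
  · have : Nonempty (Fin ((t + 1 + 1) * s)) := ⟨⟨0, by positivity⟩⟩
    have h1 : G.minDegree = (t + 1) * s := by
      obtain ⟨v, hv⟩ := G.exists_minimal_degree_vertex
      rw [hv]
      convert hreg v
    rw [h1]
    push_cast
    field_simp
  let f : Sym2 (Fin ((t + 1 + 1) * s)) → Fin q := Sym2.lift
    ⟨fun u v => if p u = 0 ∧ p v ≠ 0 then g (a u) else if p v = 0 ∧ p u ≠ 0 then g (a v)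
      else h s(p u, p v), by
      intro u v
      by_cases h1 : p u = 0 <;> by_cases h2 : p v = 0 <;> simp [h1, h2, Sym2.eq_swap]⟩
  have hf0 : ∀ u v, p u = 0 → p v ≠ 0 → f s(u,v) = g (a u) := by
    intro u v h1 h2; simp [f, h1, h2]
  have hf1 : ∀ u v, p u ≠ 0 → p v ≠ 0 → f s(u,v) = h s(p u, p v) := by
    intro u v h1 h2; simp [f, h1, h2]
  clear_value f
  refine ⟨f, ?_⟩
  rintro T ⟨hT1, hT2, hT3⟩ c
  have hTp : ∀ K ∈ T, Set.InjOn p K := by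
    intro K hK x hx y hy hxy
    by_contra hne
    exact (hadj x y).1 ((hT1 K hK).isClique hx hy hne) hxy
  have hTc : ∀ K ∈ T, K.card = t + 1 := fun K hK => (hT1 K hK).card_eq
  have hTn : T.card = (t + 1 + 1) * (2 * q * m) := by
    have h1 := aux_sum T hT2 hT3 (fun _ => True)
    simp only [Finset.filter_true, Finset.card_univ, Fintype.card_fin] at h1
    rw [Finset.sum_congr rfl hTc] at h1
    simp only [Finset.sum_const, smul_eq_mul] at h1
    apply Nat.eq_of_mul_eq_mul_right (Nat.succ_pos t)
    rw [Nat.succ_eq_add_one, h1, hs]; ring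
  have hE : tilingEdgeCount T = T.card * b := by
    unfold tilingEdgeCount
    rw [Finset.sum_congr rfl (g := fun _ => b)]
    · simp
    · intro K hK
      have := aux_card_nondiag K
      rw [hTc K hK, Nat.choose_two_right] at this
      convert this
  have hC : tilingColorCount f T c = t * w c
      + ∑ K ∈ T, auxB p f c K := by
    unfold tilingColorCount
    rw [← hac c, ← aux_sum T hT2 hT3, Finset.mul_sum, ← Finset.sum_add_distrib]
    refine Finset.sum_congr rfl fun K hK => ?_
    have h1 := aux_A p (fun v => g (a v)) f hf0 K (hTc K hK) (hTp K hK) c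
    rw [Nat.add_sub_cancel] at h1
    rw [← h1, ← aux_split]
  by_cases hc : c ∈ I
  · obtain ⟨e, he, hec⟩ := Finset.mem_image.1 hc
    revert he hec
    induction e with | h i j =>
    intro he hec
    simp only [hD, Finset.mem_filter, Finset.mk_mem_sym2_iff, Finset.mem_erase,
      Finset.mem_univ, and_true, Sym2.mk_isDiag_iff] at he
    have hB : ∑ K ∈ T, (auxB p f c K + 1) = ∑ K ∈ T, ((K.filter fun v => p v = i).card
        + (K.filter fun v => p v = j).card) := Finset.sum_congr rfl fun K hK =>
      aux_B1 p f h hinj hf1 K (hTc K hK) (hTp K hK) c i j he.1.1 he.1.2 he.2 hec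
    rw [Finset.sum_add_distrib, Finset.sum_add_distrib, aux_sum T hT2 hT3, aux_sum T hT2 hT3,
      hpc, hpc] at hB
    simp only [Finset.sum_const, smul_eq_mul, mul_one] at hB
    have hwc : w c = d * m := by rw [hw]; simp [hc]
    rw [hE]
    have key : tilingColorCount f T c + T.card = t * (d * m) + 2 * s := by
      rw [hC, hwc]; omega
    rw [hTn] at key ⊢
    have hs2 : 2 * s = 2 * (2 * q * (t + 1) * m) := by rw [← hs]
    rw [hs2] at key
    have e3 : tilingColorCount f T c = t * ((t + 1 + 1) * (t + 1)) * m := by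
      rw [hd]; linarith
    rw [e3]
    have e4 : (t + 1 + 1) * (2 * q * m) * b = (t + 1 + 1) * (q * m) * (2 * b) := by ring
    rw [e4, hbt]; ring
  · have hB : ∑ K ∈ T, auxB p f c K
        = 0 := by
      refine Finset.sum_eq_zero fun K hK => aux_B2 p f h hf1 K (hTp K hK) c ?_
      intro i j hi hj hij hh
      refine hc (Finset.mem_image.2 ⟨s(i,j), ?_, hh⟩)
      simp [hD, hi, hj, hij]
    have hwc : w c = (2 * q + d) * m := by rw [hw]; simp [hc]
    rw [hC, hB, hwc, hE, hTn, ← hd]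
    have e4 : (t + 1 + 1) * (2 * q * m) * b = (t + 1 + 1) * (q * m) * (2 * b) := by ring
    rw [e4, hbt]; ring
end

section
/- Let r ≥ 3 and q ≥ C(r+1,2). Then there are infinitely many integers n divisible by r for which there exists an n-vertex graph G with minimum degree δ(G) = (1/2 + r(r−1)/(4q))·n and a q-edge-coloring f : E(G) → {1,…,q} such that every K_r-tiling of G has discrepancy 0 with respect to f; that is, in every K_r-tiling of G every color appears on exactly e(T)/q of the edges of the tiling T. -/
open Finset

variable {V : Type*}

section Helpers

variable {s r q : ℕ}

/-- The color of a pair of labels. -/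
def labelColor (enc : Fin s ⊕ {z : Sym2 (Fin r) // ¬ z.IsDiag} → Fin q) (c0 : Fin q) :
    Fin s ⊕ Fin r → Fin s ⊕ Fin r → Fin q
  | Sum.inl _, Sum.inl _ => c0
  | Sum.inl k, Sum.inr _ => enc (Sum.inl k)
  | Sum.inr _, Sum.inl k => enc (Sum.inl k)
  | Sum.inr i, Sum.inr j => if h : i = j then c0 else enc (Sum.inr ⟨s(i, j), by simpa using h⟩)

theorem labelColor_symm (enc : Fin s ⊕ {z : Sym2 (Fin r) // ¬ z.IsDiag} → Fin q) (c0 : Fin q)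
    (x y : Fin s ⊕ Fin r) : labelColor enc c0 x y = labelColor enc c0 y x := by
  rcases x with k | i <;> rcases y with l | j <;> simp only [labelColor]
  by_cases h : i = j
  · simp [h]
  · have h' : ¬ j = i := fun e => h e.symm
    simp only [h, h', dif_neg, not_false_eq_true]
    congr 2
    exact Subtype.ext Sym2.eq_swap

/-- The coloring of the edges. -/
def edgeColor {U : Type*} (L : U → Fin s ⊕ Fin r)
    (enc : Fin s ⊕ {z : Sym2 (Fin r) // ¬ z.IsDiag} → Fin q) (c0 : Fin q) : Sym2 U → Fin q :=
  Sym2.lift ⟨fun u v => labelColor enc c0 (L u) (L v), fun _ _ => labelColor_symm enc c0 _ _⟩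

/-- The graph. -/
def labelGraph {U : Type*} (L : U → Fin s ⊕ Fin r) : SimpleGraph U where
  Adj u v := L u ≠ L v ∧ ¬ ((L u).isLeft ∧ (L v).isLeft)
  symm := ⟨fun u v h => ⟨h.1.symm, fun h' => h.2 ⟨h'.2, h'.1⟩⟩⟩
  loopless := ⟨fun u h => h.1 rfl⟩

theorem labelColor_eq_inl {enc : Fin s ⊕ {z : Sym2 (Fin r) // ¬ z.IsDiag} → Fin q}
    (henc : Function.Injective enc) (c0 : Fin q) {x y : Fin s ⊕ Fin r} (hxy : x ≠ y)
    (hl : ¬ (x.isLeft ∧ y.isLeft)) (k : Fin s) :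
    labelColor enc c0 x y = enc (Sum.inl k) ↔ x = Sum.inl k ∨ y = Sum.inl k := by
  rcases x with k' | i <;> rcases y with l | j <;> simp_all [labelColor, henc.eq_iff]

theorem labelColor_eq_inr {enc : Fin s ⊕ {z : Sym2 (Fin r) // ¬ z.IsDiag} → Fin q}
    (henc : Function.Injective enc) (c0 : Fin q) {x y : Fin s ⊕ Fin r} (hxy : x ≠ y)
    (hl : ¬ (x.isLeft ∧ y.isLeft)) (i j : Fin r) (hij : ¬ (s(i, j)).IsDiag) :
    labelColor enc c0 x y = enc (Sum.inr ⟨s(i, j), hij⟩) ↔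
      (x = Sum.inr i ∧ y = Sum.inr j) ∨ (x = Sum.inr j ∧ y = Sum.inr i) := by
  rcases x with k' | i <;> rcases y with l | j <;> simp_all [labelColor, henc.eq_iff]

variable {U : Type*} [DecidableEq U]

theorem count_inl (L : U → Fin s ⊕ Fin r)
    {enc : Fin s ⊕ {z : Sym2 (Fin r) // ¬ z.IsDiag} → Fin q}
    (henc : Function.Injective enc) (c0 : Fin q) (K : Finset U)
    (hK : (labelGraph L).IsNClique r K) (k : Fin s) :
    (K.sym2.filter fun e => ¬ e.IsDiag ∧ edgeColor L enc c0 e = enc (Sum.inl k)).card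
      = (r - 1) * (K.filter fun v => L v = Sum.inl k).card := by
  have hadj : ∀ u ∈ K, ∀ v ∈ K, u ≠ v → (labelGraph L).Adj u v :=
    fun u hu v hv h => hK.isClique hu hv h
  have hchar : ∀ u ∈ K, ∀ v ∈ K, u ≠ v →
      (edgeColor L enc c0 s(u, v) = enc (Sum.inl k) ↔ L u = Sum.inl k ∨ L v = Sum.inl k) := by
    intro u hu v hv h
    exact labelColor_eq_inl henc c0 (hadj u hu v hv h).1 (hadj u hu v hv h).2 k
  have hinj : ∀ u ∈ K, ∀ v ∈ K, L u = L v → u = v := by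
    intro u hu v hv h
    by_contra hne
    exact (hadj u hu v hv hne).1 h
  by_cases hex : ∃ v ∈ K, L v = Sum.inl k
  · obtain ⟨v, hv, hvk⟩ := hex
    have h1 : (K.filter fun v => L v = Sum.inl k) = {v} := by
      ext u
      simp only [mem_filter, mem_singleton]
      constructor
      · rintro ⟨hu, h⟩
        exact hinj u hu v hv (h.trans hvk.symm)
      · rintro rfl
        exact ⟨hv, hvk⟩
    have h2 : (K.sym2.filter fun e => ¬ e.IsDiag ∧ edgeColor L enc c0 e = enc (Sum.inl k))
        = (K.erase v).image (fun u => s(v, u)) := by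
      ext e
      induction e using Sym2.ind with
      | _ x y =>
        simp only [mem_filter, Finset.mk_mem_sym2_iff, Sym2.mk_isDiag_iff, mem_image, mem_erase]
        constructor
        · rintro ⟨⟨hx, hy⟩, hne, hc⟩
          rcases (hchar x hx y hy hne).1 hc with h | h
          · have := hinj x hx v hv (h.trans hvk.symm)
            subst this
            exact ⟨y, ⟨fun e => hne e.symm, hy⟩, rfl⟩
          · have := hinj y hy v hv (h.trans hvk.symm)
            subst this
            exact ⟨x, ⟨hne, hx⟩, Sym2.eq_swap⟩
        · rintro ⟨u, ⟨hne, hu⟩, he⟩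
          have hc := (hchar v hv u hu (fun e => hne e.symm)).2 (Or.inl hvk)
          rw [he] at hc
          rcases Sym2.eq_iff.1 he with ⟨rfl, rfl⟩ | ⟨rfl, rfl⟩
          · exact ⟨⟨hv, hu⟩, fun e => hne e.symm, hc⟩
          · exact ⟨⟨hu, hv⟩, hne, hc⟩
    rw [h1, h2, card_image_of_injective, card_erase_of_mem hv, hK.card_eq]
    · simp
    · intro a b hab
      exact Sym2.congr_right.1 hab
  · push Not at hex
    have h1 : (K.filter fun v => L v = Sum.inl k) = ∅ :=
      Finset.filter_eq_empty_iff.2 fun v hv => hex v hv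
    rw [h1, card_empty, mul_zero, card_eq_zero, Finset.filter_eq_empty_iff]
    intro e
    induction e using Sym2.ind with
    | _ x y =>
      simp only [Finset.mk_mem_sym2_iff, Sym2.mk_isDiag_iff]
      rintro ⟨hx, hy⟩ ⟨hne, hc⟩
      rcases (hchar x hx y hy hne).1 hc with h | h
      · exact hex x hx h
      · exact hex y hy h

theorem count_inr (L : U → Fin s ⊕ Fin r)
    {enc : Fin s ⊕ {z : Sym2 (Fin r) // ¬ z.IsDiag} → Fin q}
    (henc : Function.Injective enc) (c0 : Fin q) (K : Finset U)
    (hK : (labelGraph L).IsNClique r K) (i j : Fin r) (hij : ¬ (s(i, j)).IsDiag) :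
    (K.sym2.filter fun e => ¬ e.IsDiag ∧
        edgeColor L enc c0 e = enc (Sum.inr ⟨s(i, j), hij⟩)).card + 1
      = (K.filter fun v => L v = Sum.inr i).card + (K.filter fun v => L v = Sum.inr j).card := by
  have hadj : ∀ u ∈ K, ∀ v ∈ K, u ≠ v → (labelGraph L).Adj u v :=
    fun u hu v hv h => hK.isClique hu hv h
  have hchar : ∀ u ∈ K, ∀ v ∈ K, u ≠ v →
      (edgeColor L enc c0 s(u, v) = enc (Sum.inr ⟨s(i, j), hij⟩) ↔
        (L u = Sum.inr i ∧ L v = Sum.inr j) ∨ (L u = Sum.inr j ∧ L v = Sum.inr i)) := by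
    intro u hu v hv h
    exact labelColor_eq_inr henc c0 (hadj u hu v hv h).1 (hadj u hu v hv h).2 i j hij
  have hinj : ∀ u ∈ K, ∀ v ∈ K, L u = L v → u = v := by
    intro u hu v hv h
    by_contra hne
    exact (hadj u hu v hv hne).1 h
  have hij' : i ≠ j := by simpa using hij
  have hone : ∀ x : Fin s ⊕ Fin r, ∀ v ∈ K, L v = x → (K.filter fun v => L v = x) = {v} := by
    intro x v hv hvx
    ext u
    simp only [mem_filter, mem_singleton]
    constructor
    · rintro ⟨hu, h⟩
      exact hinj u hu v hv (h.trans hvx.symm)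
    · rintro rfl
      exact ⟨hv, hvx⟩
  have hzero : ∀ x : Fin s ⊕ Fin r, (∀ v ∈ K, L v ≠ x) → (K.filter fun v => L v = x) = ∅ :=
    fun x h => Finset.filter_eq_empty_iff.2 fun v hv => h v hv
  have hempty : ((∀ v ∈ K, L v ≠ Sum.inr i) ∨ (∀ v ∈ K, L v ≠ Sum.inr j)) →
      (K.sym2.filter fun e => ¬ e.IsDiag ∧
        edgeColor L enc c0 e = enc (Sum.inr ⟨s(i, j), hij⟩)) = ∅ := by
    intro hh
    rw [Finset.filter_eq_empty_iff]
    intro e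
    induction e using Sym2.ind with
    | _ x y =>
      simp only [Finset.mk_mem_sym2_iff, Sym2.mk_isDiag_iff]
      rintro ⟨hx, hy⟩ ⟨hne, hc⟩
      have := (hchar x hx y hy hne).1 hc
      have a1 := hh
      grind
  by_cases hi : ∃ v ∈ K, L v = Sum.inr i
  · obtain ⟨v, hv, hvi⟩ := hi
    by_cases hj : ∃ w ∈ K, L w = Sum.inr j
    · obtain ⟨w, hw, hwj⟩ := hj
      have hvw : v ≠ w := by
        rintro rfl
        rw [hvi] at hwj
        exact hij' (Sum.inr_injective hwj)
      have h2 : (K.sym2.filter fun e => ¬ e.IsDiag ∧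
          edgeColor L enc c0 e = enc (Sum.inr ⟨s(i, j), hij⟩)) = {s(v, w)} := by
        ext e
        induction e using Sym2.ind with
        | _ x y =>
          simp only [mem_filter, Finset.mk_mem_sym2_iff, Sym2.mk_isDiag_iff, mem_singleton]
          constructor
          · rintro ⟨⟨hx, hy⟩, hne, hc⟩
            rcases (hchar x hx y hy hne).1 hc with ⟨h, h'⟩ | ⟨h, h'⟩
            · rw [hinj x hx v hv (h.trans hvi.symm), hinj y hy w hw (h'.trans hwj.symm)]
            · rw [hinj y hy v hv (h'.trans hvi.symm), hinj x hx w hw (h.trans hwj.symm)]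
              exact Sym2.eq_swap
          · intro he
            have hc := (hchar v hv w hw hvw).2 (Or.inl ⟨hvi, hwj⟩)
            rw [← he] at hc
            rcases Sym2.eq_iff.1 he with ⟨rfl, rfl⟩ | ⟨rfl, rfl⟩
            · exact ⟨⟨hv, hw⟩, hvw, hc⟩
            · exact ⟨⟨hw, hv⟩, hvw.symm, hc⟩
      rw [h2, hone _ v hv hvi, hone _ w hw hwj]
      simp
    · push Not at hj
      rw [hempty (Or.inr hj), hone _ v hv hvi, hzero _ hj]
      simp
  · push Not at hi
    have hj : ∃ w ∈ K, L w = Sum.inr j := by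
      by_contra hj
      push Not at hj
      -- labels of `K` lie in a set of small size
      have hlt : (K.filter fun v => (L v).isLeft).card ≤ 1 := by
        rw [Finset.card_le_one]
        intro a ha b hb
        simp only [mem_filter] at ha hb
        by_contra hne
        exact (hadj a ha.1 b hb.1 hne).2 ⟨ha.2, hb.2⟩
      have hrt : (K.filter fun v => ¬ (L v).isLeft).card ≤ r - 2 := by
        have hle : (K.filter fun v => ¬ (L v).isLeft).card ≤
            (((Finset.univ : Finset (Fin r)).erase i).erase j).card := by
          have hc := Finset.card_le_card_of_injOn (s := K.filter fun v => ¬ (L v).isLeft)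
            (t := ((((Finset.univ : Finset (Fin r)).erase i).erase j).image
              (Sum.inr : Fin r → Fin s ⊕ Fin r))) L ?_ ?_
          · exact hc.trans Finset.card_image_le
          · intro v hv
            simp only [coe_filter, Set.mem_ofPred_eq] at hv
            obtain ⟨hvK, hvl⟩ := hv
            cases hLv : L v with
            | inl k => simp [hLv] at hvl
            | inr l =>
              have a1 : l ≠ i := fun e => hi v hvK (by rw [hLv, e])
              have a2 : l ≠ j := fun e => hj v hvK (by rw [hLv, e])
              simp [a1, a2]
          · intro a ha b hb hab
            simp only [coe_filter, Set.mem_ofPred_eq] at ha hb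
            exact hinj a ha.1 b hb.1 hab
        rw [card_erase_of_mem (by simp [hij'.symm]), card_erase_of_mem (by simp)] at hle
        simp only [card_univ, Fintype.card_fin] at hle
        omega
      have hsum := Finset.card_filter_add_card_filter_not (s := K) (fun v => (L v).isLeft = true)
      have hcard := hK.card_eq
      have h1 := i.2
      have h2 := j.2
      have h3 : i.1 ≠ j.1 := fun e => hij' (Fin.ext e)
      omega
    obtain ⟨w, hw, hwj⟩ := hj
    rw [hempty (Or.inl hi), hone _ w hw hwj, hzero _ hi]
    simp

theorem sum_fiber [Fintype U] {G : SimpleGraph U} (T : Finset (Finset U)) (hT : IsKrTiling G r T)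
    (P : U → Prop) [DecidablePred P] :
    ∑ K ∈ T, (K.filter P).card = (Finset.univ.filter P).card := by
  obtain ⟨-, h2, h3⟩ := hT
  rw [← h3, Finset.filter_biUnion, Finset.card_biUnion]
  · rfl
  · intro K hK K' hK' hne
    exact Finset.disjoint_filter_filter (h2 K hK K' hK' hne)

theorem edges_clique {G : SimpleGraph U} (K : Finset U) (hK : G.IsNClique r K) :
    (K.sym2.filter fun e => ¬ e.IsDiag).card = r.choose 2 := by
  rw [← hK.card_eq, ← Sym2.card_image_offDiag]
  congr 1
  ext e
  induction e using Sym2.ind with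
  | _ x y =>
    simp only [mem_filter, Finset.mk_mem_sym2_iff, Sym2.mk_isDiag_iff, mem_image, mem_offDiag,
      Prod.exists]
    constructor
    · rintro ⟨⟨hx, hy⟩, hne⟩
      exact ⟨x, y, ⟨hx, hy, hne⟩, rfl⟩
    · rintro ⟨a, b, ⟨ha, hb, hne⟩, he⟩
      rcases Sym2.eq_iff.1 he with ⟨rfl, rfl⟩ | ⟨rfl, rfl⟩
      · exact ⟨⟨ha, hb⟩, hne⟩
      · exact ⟨⟨hb, ha⟩, hne.symm⟩

theorem main_count [Fintype U] (m : ℕ) (L : U → Fin s ⊕ Fin r) (hr : 3 ≤ r)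
    (hn : Fintype.card U = r * (2 * q * m))
    (hl : ∀ k, (Finset.univ.filter fun v => L v = Sum.inl k).card = r * m)
    (hb : ∀ i, (Finset.univ.filter fun v => L v = Sum.inr i).card = m * (q + r.choose 2))
    {enc : Fin s ⊕ {z : Sym2 (Fin r) // ¬ z.IsDiag} → Fin q}
    (henc : Function.Bijective enc) (c0 : Fin q)
    (T : Finset (Finset U)) (hT : IsKrTiling (labelGraph L) r T) (c : Fin q) :
    q * tilingColorCount (edgeColor L enc c0) T c = tilingEdgeCount T := by
  have hcl := hT.1
  have hTc : T.card = 2 * q * m := by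
    have h := sum_fiber T hT (fun _ => True)
    simp only [Finset.filter_true, Finset.card_univ] at h
    rw [Finset.sum_congr rfl (fun K hK => (hcl K hK).card_eq), Finset.sum_const, hn,
      smul_eq_mul, mul_comm] at h
    exact Nat.eq_of_mul_eq_mul_left (by omega) h
  have hE : tilingEdgeCount T = 2 * q * m * r.choose 2 := by
    unfold tilingEdgeCount
    rw [Finset.sum_congr rfl (fun K hK => edges_clique K (hcl K hK)), Finset.sum_const, hTc,
      smul_eq_mul]
  have h2p : 2 * r.choose 2 = r * (r - 1) := by
    rw [Nat.choose_two_right, Nat.mul_div_cancel' (Nat.even_mul_pred_self r).two_dvd]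
  rw [hE]
  obtain ⟨x, rfl⟩ := henc.2 c
  rcases x with k | ⟨z, hz⟩
  · have : tilingColorCount (edgeColor L enc c0) T (enc (Sum.inl k)) = (r - 1) * (r * m) := by
      unfold tilingColorCount
      rw [Finset.sum_congr rfl (fun K hK => count_inl L henc.1 c0 K (hcl K hK) k),
        ← Finset.mul_sum, sum_fiber T hT, hl]
    rw [this]
    calc q * ((r - 1) * (r * m)) = q * m * (r * (r - 1)) := by ring
      _ = _ := by rw [← h2p]; ring
  · induction z using Sym2.ind with
    | _ i j =>
      have : tilingColorCount (edgeColor L enc c0) T (enc (Sum.inr ⟨s(i, j), hz⟩)) + 2 * q * m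
          = m * (q + r.choose 2) + m * (q + r.choose 2) := by
        unfold tilingColorCount
        rw [← hTc, Finset.card_eq_sum_ones, ← Finset.sum_add_distrib,
          Finset.sum_congr rfl (fun K hK => count_inr L henc.1 c0 K (hcl K hK) i j hz),
          Finset.sum_add_distrib, sum_fiber T hT, sum_fiber T hT, hb, hb]
      have h' : tilingColorCount (edgeColor L enc c0) T (enc (Sum.inr ⟨s(i, j), hz⟩))
          = 2 * m * r.choose 2 := by
        have e : m * (q + r.choose 2) + m * (q + r.choose 2)
          = 2 * m * r.choose 2 + 2 * q * m := by ring
        omega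
      rw [h']
      ring

theorem main_degree {U : Type*} [Fintype U] (m : ℕ) (L : U → Fin s ⊕ Fin r)
    (hs : 0 < s) (hm : 0 < m) (hr : 3 ≤ r) (hsq : s + r.choose 2 = q) (hsr : r ≤ s)
    (hn : Fintype.card U = r * (2 * q * m))
    (hl : ∀ k, (Finset.univ.filter fun v => L v = Sum.inl k).card = r * m)
    (hb : ∀ i, (Finset.univ.filter fun v => L v = Sum.inr i).card = m * (q + r.choose 2))
    [DecidableRel (labelGraph L).Adj] :
    (labelGraph L).minDegree = r * m * (q + r.choose 2) := by
  classical
  have hA : (Finset.univ.filter fun v => (L v).isLeft = true).card = s * (r * m) := by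
    have : (Finset.univ.filter fun v => (L v).isLeft = true)
        = (Finset.univ : Finset (Fin s)).biUnion
          (fun k => Finset.univ.filter fun v => L v = Sum.inl k) := by
      ext v
      simp [Sum.isLeft_iff]
    rw [this, Finset.card_biUnion, Finset.sum_congr rfl (fun k _ => hl k)]
    · simp
    · intro k _ k' _ hne
      rw [Function.onFun, Finset.disjoint_filter]
      intro v _ h h'
      exact hne (Sum.inl_injective (h.symm.trans h'))
  have hdeg1 : ∀ v, (L v).isLeft = true →
      (labelGraph L).degree v = r * m * (q + r.choose 2) := by
    intro v hv
    have h1 : (labelGraph L).neighborFinset v = Finset.univ.filter fun v => ¬ (L v).isLeft = true := by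
      ext w
      rw [SimpleGraph.mem_neighborFinset]
      simp only [labelGraph, mem_filter, mem_univ, true_and]
      constructor
      · exact fun h h' => h.2 ⟨hv, h'⟩
      · exact fun h => ⟨fun e => h (e ▸ hv), fun h' => h h'.2⟩
    have h2 := Finset.card_filter_add_card_filter_not (s := (Finset.univ : Finset U))
      (fun v => (L v).isLeft = true)
    rw [hA, Finset.card_univ, hn] at h2
    rw [← SimpleGraph.card_neighborFinset_eq_degree, h1]
    have e : r * (2 * q * m) = s * (r * m) + r * m * (q + r.choose 2) := by
      rw [← hsq]; ring
    omega
  have hdeg2 : ∀ v, ¬ (L v).isLeft = true →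
      r * m * (q + r.choose 2) ≤ (labelGraph L).degree v := by
    intro v hv
    obtain ⟨i, hi⟩ : ∃ i, L v = Sum.inr i := by
      cases h : L v with
      | inl k => simp [h] at hv
      | inr i => exact ⟨i, rfl⟩
    have h1 : (labelGraph L).neighborFinset v = Finset.univ.filter fun v => ¬ L v = Sum.inr i := by
      ext w
      rw [SimpleGraph.mem_neighborFinset]
      simp only [labelGraph, mem_filter, mem_univ, true_and]
      constructor
      · exact fun h h' => h.1 (hi.trans h'.symm)
      · exact fun h => ⟨fun e => h (e.symm.trans hi), fun h' => hv h'.1⟩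
    have h2 := Finset.card_filter_add_card_filter_not (s := (Finset.univ : Finset U))
      (fun v => L v = Sum.inr i)
    rw [hb, Finset.card_univ, hn] at h2
    rw [← SimpleGraph.card_neighborFinset_eq_degree, h1]
    have e : r * (2 * q * m) = s * (r * m) + r * m * (q + r.choose 2) := by
      rw [← hsq]; ring
    have h2p : 2 * r.choose 2 = r * (r - 1) := by
      rw [Nat.choose_two_right, Nat.mul_div_cancel' (Nat.even_mul_pred_self r).two_dvd]
    have h3 : m * (q + r.choose 2) ≤ s * (r * m) := by
      have : q + r.choose 2 ≤ s * r := by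
        rw [← hsq, add_assoc, ← two_mul, h2p]
        obtain ⟨t, rfl⟩ : ∃ t, r = t + 1 := ⟨r - 1, by omega⟩
        simp only [Nat.add_sub_cancel]
        nlinarith
      calc m * (q + r.choose 2) ≤ m * (s * r) := Nat.mul_le_mul_left _ this
        _ = _ := by ring
    omega
  have hpos : 0 < (Finset.univ.filter fun v => L v = Sum.inl (⟨0, hs⟩ : Fin s)).card := by
    rw [hl]
    exact Nat.mul_pos (by omega) hm
  obtain ⟨v0, hv0⟩ := Finset.card_pos.1 hpos
  have hv0' : (L v0).isLeft = true := by
    simp only [mem_filter, mem_univ, true_and] at hv0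
    simp [hv0]
  haveI : Nonempty U := ⟨v0⟩
  apply le_antisymm
  · rw [← hdeg1 v0 hv0']
    exact (labelGraph L).minDegree_le_degree v0
  · apply SimpleGraph.le_minDegree_of_forall_le_degree
    intro v
    by_cases hv : (L v).isLeft = true
    · exact (hdeg1 v hv).ge
    · exact hdeg2 v hv

theorem exists_label (a b n : ℕ) (hn : n = s * a + r * b) :
    ∃ L : Fin n → Fin s ⊕ Fin r,
      (∀ k, (Finset.univ.filter fun v => L v = Sum.inl k).card = a) ∧
      (∀ i, (Finset.univ.filter fun v => L v = Sum.inr i).card = b) := by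
  have e : Fin n ≃ (Fin s × Fin a) ⊕ (Fin r × Fin b) :=
    Fintype.equivOfCardEq (by simp [hn])
  refine ⟨fun v => Sum.map Prod.fst Prod.fst (e v), fun k => ?_, fun i => ?_⟩
  · have : (Finset.univ.filter fun v => Sum.map Prod.fst Prod.fst (e v) = Sum.inl k)
        = (Finset.univ : Finset (Fin a)).image (fun x => e.symm (Sum.inl (k, x))) := by
      ext v
      simp only [mem_filter, mem_univ, true_and, mem_image, Equiv.symm_apply_eq]
      rcases e v with ⟨x, y⟩ | ⟨x, y⟩ <;> simp [eq_comm]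
    rw [this, card_image_of_injective]
    · simp
    · intro x y h
      simpa using h
  · have : (Finset.univ.filter fun v => Sum.map Prod.fst Prod.fst (e v) = Sum.inr i)
        = (Finset.univ : Finset (Fin b)).image (fun x => e.symm (Sum.inr (i, x))) := by
      ext v
      simp only [mem_filter, mem_univ, true_and, mem_image, Equiv.symm_apply_eq]
      rcases e v with ⟨x, y⟩ | ⟨x, y⟩ <;> simp [eq_comm]
    rw [this, card_image_of_injective]
    · simp
    · intro x y h
      simpa using h

end Helpers

attribute [local instance] Classical.propDecidable

/-- **Lemma.** For `r ≥ 3` and `q ≥ C(r+1,2)` there are infinitely many `n` divisible by `r`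
admitting an `n`-vertex graph with `δ(G) = (1/2 + r(r−1)/(4q))n` and a `q`-edge-coloring such
that every `K_r`-tiling has discrepancy `0`. -/
theorem lower_bound_construction_large_q (r q : ℕ) (hr : 3 ≤ r)
    (hq : (r + 1) * r / 2 ≤ q) (N : ℕ) :
    ∃ n : ℕ, N < n ∧ r ∣ n ∧
      ∃ G : SimpleGraph (Fin n),
        (G.minDegree : ℚ) = ((1 : ℚ) / 2 + (r : ℚ) * ((r : ℚ) - 1) / (4 * q)) * n ∧
        ∃ f : Sym2 (Fin n) → Fin q,
          ∀ T : Finset (Finset (Fin n)), IsKrTiling G r T →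
            ∀ c : Fin q, q * tilingColorCount f T c = tilingEdgeCount T := by
  have h2p : 2 * r.choose 2 = r * (r - 1) := by
    rw [Nat.choose_two_right, Nat.mul_div_cancel' (Nat.even_mul_pred_self r).two_dvd]
  have hch : (r + 1) * r / 2 = r + r.choose 2 := by
    have h := Nat.choose_two_right (r + 1)
    rw [Nat.add_sub_cancel] at h
    rw [← h, Nat.choose_succ_succ' r 1, Nat.choose_one_right]
  rw [hch] at hq
  obtain ⟨s, hsq⟩ : ∃ s, s + r.choose 2 = q := ⟨q - r.choose 2, by omega⟩
  have hsr : r ≤ s := by omega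
  have hq0 : 0 < q := by omega
  have hcard : r * (2 * q * (N + 1)) = s * (r * (N + 1)) + r * ((N + 1) * (q + r.choose 2)) := by
    rw [← hsq]; ring
  obtain ⟨L, hl, hb⟩ := exists_label (s := s) (r := r) _ _ _ hcard
  have enc : Fin s ⊕ {z : Sym2 (Fin r) // ¬ z.IsDiag} ≃ Fin q := by
    apply Fintype.equivOfCardEq
    rw [Fintype.card_sum, Sym2.card_subtype_not_diag]
    simpa using hsq
  refine ⟨r * (2 * q * (N + 1)), ?_, Dvd.intro _ rfl, labelGraph L, ?_,
    edgeColor L enc ⟨0, hq0⟩, ?_⟩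
  · have : 1 ≤ r * (2 * q) := Nat.mul_pos (by omega) (by omega)
    nlinarith
  · rw [main_degree (q := q) (N + 1) L (by omega) (by omega) hr hsq hsr (by simp)
      (fun k => by convert hl k) (fun i => by convert hb i)]
    have h2q : 2 * (r.choose 2 : ℚ) = r * ((r : ℚ) - 1) := by
      have := congrArg (Nat.cast : ℕ → ℚ) h2p
      rw [Nat.cast_mul, Nat.cast_mul, Nat.cast_sub (by omega)] at this
      simpa using this
    have hq' : (q : ℚ) ≠ 0 := by exact_mod_cast hq0.ne'
    rw [← h2q]
    push_cast
    field_simp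
    ring
  · intro T hT c
    convert main_count (q := q) (N + 1) L hr (by simp) (fun k => by convert hl k)
      (fun i => by convert hb i) enc.bijective ⟨0, hq0⟩ T (by convert hT) c
end
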